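/- arXiv:1708.00728 — 2 statements merged into one kernel-verified Lean document; each statement's English description precedes it below -/
import Mathlib

section
/- Assume: G connected with incidence matrix B, E = [I_p;0] with p ≥ 1; each ȳ_i in the range of h_i; L the Laplacian of a balanced strongly connected digraph; each h_i, f_k, g_i continuously differentiable and strictly increasing with range(f_k) = (λ_k⁻, λ_k⁺) and range(g_i) = (u_i⁻, u_i⁺); ū = Q⁻¹(λ*·1_p − r), λ* = (1_nᵀd + 1_pᵀQ⁻¹r)/(1_pᵀQ⁻¹1_p), with ū_i ∈ range(g_i) for all i; and there exists λ̄ with Bλ̄ = Eū − d and λ̄_k ∈ range(f_k) for all k. Then every solution t ↦ (x(t), μ(t), ξ(t), θ(t), φ(t)), defined on [0,∞), of the closed-loop system T_x ẋ = −B f(μ) + E g(θ) − d; T_μ μ̇ = Bᵀ(h(x) − ȳ) − (f(μ) − ξ); T_ξ ξ̇ = f(μ) − ξ; T_θ θ̇ = −Eᵀ(h(x) − ȳ) − (g(θ) − φ); T_φ φ̇ = g(θ) − φ − Q L (Q φ + r) satisfies: (a) λ_k⁻ < f_k(μ_k(t)) < λ_k⁺ and u_i⁻ < g_i(θ_i(t))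 < u_i⁺ for all t ≥ 0; (b) the solution converges as t → ∞ to a point (x*, μ*, ξ*, θ*, φ*) with h(x*) = ȳ, g(θ*) = ū, ξ* = f(μ*) and B f(μ*) = E ū − d. -/
open Matrix BigOperators Filter Topology MeasureTheory

/-- An undirected graph on `Fin n` with `m` edges, each edge given an arbitrary
orientation: edge `k` goes from its positive end `pos k` to its negative end `neg k`. -/
structure OrientedGraph (n m : ℕ) where
  pos : Fin m → Fin n
  neg : Fin m → Fin n
  ne_ends : ∀ k, pos k ≠ neg k

namespace OrientedGraph

variable {n m : ℕ}

/-- The oriented incidence matrix `B ∈ ℝ^{n×m}`. -/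
def inc (G : OrientedGraph n m) : Matrix (Fin n) (Fin m) ℝ :=
  Matrix.of fun i k => if i = G.pos k then (1 : ℝ) else if i = G.neg k then -1 else 0

/-- Adjacency in the underlying undirected graph. -/
def Adj (G : OrientedGraph n m) (i j : Fin n) : Prop :=
  ∃ k, (G.pos k = i ∧ G.neg k = j) ∨ (G.pos k = j ∧ G.neg k = i)

/-- Connectedness of the underlying undirected graph. -/
def Connected (G : OrientedGraph n m) : Prop :=
  ∀ i j : Fin n, Relation.ReflTransGen G.Adj i j

end OrientedGraph

/-- The matrix `E = [I_p ; 0_{(n-p)×p}]` selecting the first `p` nodes. -/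
def selE (n p : ℕ) : Matrix (Fin n) (Fin p) ℝ :=
  Matrix.of fun i j => if (i : ℕ) = (j : ℕ) then 1 else 0

/-- Componentwise application of a family of scalar functions. -/
def cw {k : ℕ} (f : Fin k → ℝ → ℝ) (x : Fin k → ℝ) : Fin k → ℝ :=
  fun i => f i (x i)

/-- `λ* = (1ₙᵀ d + 1ₚᵀ Q⁻¹ r)/(1ₚᵀ Q⁻¹ 1ₚ)` for `Q = diag q`. -/
noncomputable def lamStar {n p : ℕ} (q r : Fin p → ℝ) (d : Fin n → ℝ) : ℝ :=
  ((∑ i, d i) + ∑ i, r i / q i) / (∑ i, (q i)⁻¹)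

/-- The optimal input `ū = Q⁻¹(λ*·1ₚ − r)`. -/
noncomputable def uOpt {n p : ℕ} (q r : Fin p → ℝ) (d : Fin n → ℝ) : Fin p → ℝ :=
  fun i => (lamStar q r d - r i) / q i

/-- The cost `C(u) = ½ uᵀQu + rᵀu + s` for `Q = diag q`. -/
noncomputable def cost {p : ℕ} (q r : Fin p → ℝ) (s : ℝ) (u : Fin p → ℝ) : ℝ :=
  (1 / 2) * (∑ i, q i * u i ^ 2) + (∑ i, r i * u i) + s

/-- `L` is the Laplacian matrix of a balanced, strongly connected weighted digraph:
nonpositive off-diagonal entries, zero row sums, zero column sums, and the digraph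
whose arcs are the pairs with `L i j < 0` is strongly connected. -/
structure IsBalancedStronglyConnectedLaplacian {p : ℕ} (L : Matrix (Fin p) (Fin p) ℝ) : Prop where
  offdiag_nonpos : ∀ i j, i ≠ j → L i j ≤ 0
  rowsum : L.mulVec (fun _ => 1) = 0
  colsum : Matrix.vecMul (fun _ => 1) L = 0
  sconn : ∀ i j : Fin p, Relation.ReflTransGen (fun a b => a ≠ b ∧ L a b < 0) i j


/-- Potential of a strictly increasing function, centred at `a`. -/
theorem exists_pot (h : ℝ → ℝ) (hc : Continuous h) (hm : StrictMono h) (a : ℝ) :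
    ∃ H : ℝ → ℝ, (∀ s, HasDerivAt H (h s - h a) s) ∧ H a = 0 ∧ (∀ s, 0 ≤ H s) ∧
      ∀ ε > 0, ∃ c > 0, ∀ s, c * (|s - a| - ε) ≤ H s := by
  have hcont : Continuous (fun u => h u - h a) := by fun_prop
  set H : ℝ → ℝ := fun s => ∫ u in a..s, (h u - h a) with hH
  have hd : ∀ s, HasDerivAt H (h s - h a) s := fun s =>
    (hcont.integral_hasStrictDerivAt a s).hasDerivAt
  have hHa : H a = 0 := by simp [hH]
  have hHc : Continuous H := continuous_iff_continuousAt.2 fun s => (hd s).continuousAt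
  have tan : ∀ b s, H b + (h b - h a) * (s - b) ≤ H s := by
    intro b s
    rcases lt_trichotomy b s with hbs | hbs | hbs
    · obtain ⟨c, hc1, hc2⟩ := exists_hasDerivAt_eq_slope H (fun s => h s - h a) hbs
        hHc.continuousOn (fun x _ => hd x)
      have h1 : h b < h c := hm hc1.1
      rw [eq_div_iff (by linarith)] at hc2
      nlinarith
    · subst hbs; simp
    · obtain ⟨c, hc1, hc2⟩ := exists_hasDerivAt_eq_slope H (fun s => h s - h a) hbs
        hHc.continuousOn (fun x _ => hd x)
      have h1 : h c < h b := hm hc1.2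
      rw [eq_div_iff (by linarith)] at hc2
      nlinarith
  have hpos : ∀ s, 0 ≤ H s := by
    intro s
    have := tan a s
    simp [hHa] at this
    exact this
  refine ⟨H, hd, hHa, hpos, ?_⟩
  intro ε hε
  have h1 : h a < h (a + ε) := hm (by linarith)
  have h2 : h (a - ε) < h a := hm (by linarith)
  refine ⟨min (h (a + ε) - h a) (h a - h (a - ε)), lt_min (by linarith) (by linarith), ?_⟩
  intro s
  set c := min (h (a + ε) - h a) (h a - h (a - ε)) with hcdef
  have hc0 : 0 < c := lt_min (by linarith) (by linarith)
  have hc1 : c ≤ h (a + ε) - h a := min_le_left _ _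
  have hc2 : c ≤ h a - h (a - ε) := min_le_right _ _
  rcases le_or_gt (|s - a|) ε with hs | hs
  · have := hpos s
    nlinarith
  · rcases le_total a s with has | has
    · rw [abs_of_nonneg (by linarith)] at hs ⊢
      have := tan (a + ε) s
      have := hpos (a + ε)
      nlinarith
    · rw [abs_of_nonpos (by linarith)] at hs ⊢
      have := tan (a - ε) s
      have := hpos (a - ε)
      nlinarith

section Generic

variable {ι : Type*} [Fintype ι]

/-- The Lyapunov function along a trajectory. -/
theorem exists_lyap (a : ι → ℝ → ℝ) (ha : ∀ j, Continuous (a j)) (hm : ∀ j, StrictMono (a j))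
    (T : ι → ℝ) (hT : ∀ j, 0 < T j) (F : ℝ → ι → ℝ) (z : ℝ → ι → ℝ)
    (hz : ∀ t, 0 ≤ t → ∀ j, HasDerivAt (fun s => z s j) (F t j / T j) t) (zb : ι → ℝ) :
    ∃ W : (ι → ℝ) → ℝ, Continuous W ∧ W zb = 0 ∧ (∀ y, 0 ≤ W y) ∧
      (∀ t, 0 ≤ t → HasDerivAt (fun s => W (z s)) (∑ j, (a j (z t j) - a j (zb j)) * F t j) t) ∧
      ∀ ε > 0, ∃ c > 0, ∀ y j, c * (|y j - zb j| - ε) ≤ W y := by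
  choose H hd h0 hpos hco using fun j => exists_pot (a j) (ha j) (hm j) (zb j)
  have hHc : ∀ j, Continuous (H j) := fun j =>
    continuous_iff_continuousAt.2 fun s => (hd j s).continuousAt
  have hWpos : ∀ y : ι → ℝ, 0 ≤ ∑ j, T j * H j (y j) := fun y =>
    Finset.sum_nonneg fun j _ => mul_nonneg (hT j).le (hpos j _)
  refine ⟨fun y => ∑ j, T j * H j (y j), ?_, ?_, hWpos, ?_, ?_⟩
  · refine continuous_finsetSum _ fun j _ => ?_
    exact continuous_const.mul ((hHc j).comp (continuous_apply j))
  · simp [h0]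
  · intro t ht
    refine HasDerivAt.fun_sum fun j _ => ?_
    have := ((hd j (z t j)).comp t (hz t ht j)).const_mul (T j)
    have e : (a j (z t j) - a j (zb j)) * F t j
        = T j * ((a j (z t j) - a j (zb j)) * (F t j / T j)) := by
      have := (hT j).ne'
      field_simp
    rw [e]
    exact this
  · intro ε hε
    choose c hc hcc using fun j => hco j ε hε
    rcases isEmpty_or_nonempty ι with hi | hi
    · exact ⟨1, one_pos, fun y j => (hi.false j).elim⟩
    obtain ⟨j0, hj0⟩ := Finite.exists_min (fun j => T j * c j)
    refine ⟨T j0 * c j0, mul_pos (hT _) (hc _), ?_⟩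
    intro y j
    rcases le_or_gt (|y j - zb j|) ε with hs | hs
    · have := hWpos y
      have := mul_pos (hT j0) (hc j0)
      nlinarith
    · calc T j0 * c j0 * (|y j - zb j| - ε) ≤ T j * c j * (|y j - zb j| - ε) :=
            mul_le_mul_of_nonneg_right (hj0 j) (by linarith)
        _ = T j * (c j * (|y j - zb j| - ε)) := by ring
        _ ≤ T j * H j (y j) := mul_le_mul_of_nonneg_left (hcc j _) (hT j).le
        _ ≤ _ := Finset.single_le_sum (f := fun j => T j * H j (y j))
            (fun j _ => mul_nonneg (hT j).le (hpos j _)) (Finset.mem_univ j)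

theorem antitone_of_deriv (V V' : ℝ → ℝ) (hV : ∀ t, 0 ≤ t → HasDerivAt V (V' t) t)
    (h : ∀ t, 0 ≤ t → V' t ≤ 0) {s t : ℝ} (hs : 0 ≤ s) (hst : s ≤ t) : V t ≤ V s := by
  rcases hst.eq_or_lt with rfl | hst
  · exact le_rfl
  obtain ⟨c, hc1, hc2⟩ := exists_hasDerivAt_eq_slope V V' hst
    (fun x hx => (hV x (hs.trans hx.1)).continuousAt.continuousWithinAt)
    (fun x hx => hV x (hs.trans hx.1.le))
  rw [eq_div_iff (by linarith)] at hc2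
  have := h c (hs.trans hc1.1.le)
  nlinarith

theorem gen_bounded (a : ι → ℝ → ℝ) (ha : ∀ j, Continuous (a j)) (hm : ∀ j, StrictMono (a j))
    (T : ι → ℝ) (hT : ∀ j, 0 < T j) (F : ℝ → ι → ℝ) (z : ℝ → ι → ℝ)
    (hz : ∀ t, 0 ≤ t → ∀ j, HasDerivAt (fun s => z s j) (F t j / T j) t) (zb : ι → ℝ)
    (hdis : ∀ t, 0 ≤ t → ∑ j, (a j (z t j) - a j (zb j)) * F t j ≤ 0) :
    ∃ R, ∀ t, 0 ≤ t → ∀ j, |z t j| ≤ R := by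
  obtain ⟨W, hWc, hW0, hWp, hWd, hco⟩ := exists_lyap a ha hm T hT F z hz zb
  obtain ⟨c, hc, hcc⟩ := hco 1 one_pos
  refine ⟨W (z 0) / c + 1 + ∑ j, |zb j|, ?_⟩
  intro t ht j
  have h1 := antitone_of_deriv _ _ hWd hdis le_rfl ht
  have h2 := hcc (z t) j
  have h3 : |z t j - zb j| - 1 ≤ W (z 0) / c := by
    rw [le_div_iff₀ hc]; linarith
  have h4 : |zb j| ≤ ∑ j, |zb j| :=
    Finset.single_le_sum (f := fun j => |zb j|) (fun j _ => abs_nonneg _) (Finset.mem_univ j)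
  have h5 : |z t j| ≤ |z t j - zb j| + |zb j| := by
    simpa using abs_add_le (z t j - zb j) (zb j)
  linarith

theorem gen_conv (a : ι → ℝ → ℝ) (ha : ∀ j, Continuous (a j)) (hm : ∀ j, StrictMono (a j))
    (T : ι → ℝ) (hT : ∀ j, 0 < T j) (F : ℝ → ι → ℝ) (z : ℝ → ι → ℝ)
    (hz : ∀ t, 0 ≤ t → ∀ j, HasDerivAt (fun s => z s j) (F t j / T j) t) (zb : ι → ℝ)
    (hdis : ∀ t, 0 ≤ t → ∑ j, (a j (z t j) - a j (zb j)) * F t j ≤ 0)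
    (τ : ℕ → ℝ) (hτ0 : ∀ k, 0 ≤ τ k) (hτ : Tendsto (fun k => z (τ k)) atTop (𝓝 zb)) :
    Tendsto z atTop (𝓝 zb) := by
  obtain ⟨W, hWc, hW0, hWp, hWd, hco⟩ := exists_lyap a ha hm T hT F z hz zb
  rw [tendsto_pi_nhds]
  intro j
  rw [Metric.tendsto_atTop]
  intro ε hε
  obtain ⟨c, hc, hcc⟩ := hco (ε / 2) (by linarith)
  have h1 : Tendsto (fun k => W (z (τ k))) atTop (𝓝 0) := by
    rw [← hW0]; exact (hWc.tendsto zb).comp hτ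
  obtain ⟨k, hk⟩ := (h1.eventually (gt_mem_nhds (show 0 < c * (ε / 2) by positivity))).exists
  refine ⟨τ k, fun t ht => ?_⟩
  have h2 := antitone_of_deriv _ _ hWd hdis (hτ0 k) ht
  have h3 := hcc (z t) j
  have h4 : c * (|z t j - zb j| - ε / 2) < c * (ε / 2) := by linarith
  have h5 := lt_of_mul_lt_mul_left h4 hc.le
  rw [Real.dist_eq]
  linarith

theorem gen_barbalat (a : ι → ℝ → ℝ) (ha : ∀ j, Continuous (a j)) (hm : ∀ j, StrictMono (a j))
    (T : ι → ℝ) (hT : ∀ j, 0 < T j) (Ψ : (ι → ℝ) → ι → ℝ) (hΨ : Continuous Ψ)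
    (z : ℝ → ι → ℝ)
    (hz : ∀ t, 0 ≤ t → ∀ j, HasDerivAt (fun s => z s j) (Ψ (z t) j / T j) t) (zb : ι → ℝ)
    (Φ : (ι → ℝ) → ℝ) (hΦ : Continuous Φ) (hΦ0 : ∀ y, 0 ≤ Φ y)
    (hdis : ∀ y, ∑ j, (a j (y j) - a j (zb j)) * Ψ y j = - Φ y) :
    Tendsto (fun t => Φ (z t)) atTop (𝓝 0) := by
  obtain ⟨R, hR⟩ := gen_bounded a ha hm T hT (fun t => Ψ (z t)) z hz zb
    (fun t ht => by rw [hdis]; linarith [hΦ0 (z t)])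
  obtain ⟨W, hWc, hW0, hWp, hWd, hco⟩ := exists_lyap a ha hm T hT (fun t => Ψ (z t)) z hz zb
  have hanti : ∀ s t, 0 ≤ s → s ≤ t → W (z t) ≤ W (z s) := fun s t hs hst =>
    antitone_of_deriv _ _ hWd (fun t ht => by rw [hdis]; linarith [hΦ0 (z t)]) hs hst
  have hR0 : 0 ≤ |R| := abs_nonneg R
  set K : Set (ι → ℝ) := Metric.closedBall 0 |R| with hK
  have hKc : IsCompact K := isCompact_closedBall _ _
  have hzK : ∀ t, 0 ≤ t → z t ∈ K := by
    intro t ht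
    rw [hK, mem_closedBall_zero_iff, pi_norm_le_iff_of_nonneg hR0]
    intro j
    exact (hR t ht j).trans (le_abs_self R)
  -- derivative bound
  have hΨ' : Continuous (fun y => fun j => Ψ y j / T j) := by
    refine continuous_pi fun j => ?_
    exact ((continuous_apply j).comp hΨ).div_const _
  obtain ⟨M, hM⟩ := hKc.exists_bound_of_continuousOn hΨ'.continuousOn
  have hM' : ∀ t, 0 ≤ t → ∀ j, |Ψ (z t) j / T j| ≤ |M| := fun t ht j =>
    (norm_le_pi_norm (fun j => Ψ (z t) j / T j) j).trans ((hM _ (hzK t ht)).trans (le_abs_self M))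
  have hlip : ∀ s t, 0 ≤ s → s ≤ t → ‖z t - z s‖ ≤ |M| * (t - s) := by
    intro s t hs hst
    rw [pi_norm_le_iff_of_nonneg (mul_nonneg (abs_nonneg _) (by linarith))]
    intro j
    rcases hst.eq_or_lt with rfl | hst
    · simp
    obtain ⟨c, hc1, hc2⟩ := exists_hasDerivAt_eq_slope (fun s => z s j)
      (fun t => Ψ (z t) j / T j) hst
      (fun x hx => (hz x (hs.trans hx.1) j).continuousAt.continuousWithinAt)
      (fun x hx => hz x (hs.trans hx.1.le) j)
    rw [eq_div_iff (by linarith)] at hc2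
    simp only [Pi.sub_apply]
    rw [← hc2, Real.norm_eq_abs, abs_mul, abs_of_pos (by linarith : (0:ℝ) < t - s)]
    exact mul_le_mul_of_nonneg_right (hM' c (hs.trans hc1.1.le) j) (by linarith)
  have huc := hKc.uniformContinuousOn_of_continuous hΦ.continuousOn
  rw [Metric.uniformContinuousOn_iff] at huc
  rw [Metric.tendsto_atTop]
  intro ε hε
  obtain ⟨δ, hδ, hδ'⟩ := huc (ε / 2) (by linarith)
  set S := δ / (2 * (|M| + 1)) with hS
  have hM1 : 0 < |M| + 1 := by positivity
  have hSpos : 0 < S := by positivity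
  have hMS : |M| * S < δ := by
    have : (|M| + 1) * S = δ / 2 := by rw [hS]; field_simp
    nlinarith
  -- W (z t) converges, hence is Cauchy
  by_contra hcon
  push Not at hcon
  have step : ∀ N, 0 ≤ N → ∃ t, N ≤ t ∧ W (z t) ≤ W (z N) - S * (ε / 2) := by
    intro N hN
    obtain ⟨t, ht, htε⟩ := hcon N
    have ht0 : 0 ≤ t := hN.trans ht
    rw [Real.dist_eq, sub_zero, abs_of_nonneg (hΦ0 _)] at htε
    refine ⟨t + S, by linarith, ?_⟩
    obtain ⟨c, hc1, hc2⟩ := exists_hasDerivAt_eq_slope (fun s => W (z s)) _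
      (show t < t + S by linarith)
      (fun x hx => (hWd x (ht0.trans hx.1)).continuousAt.continuousWithinAt)
      (fun x hx => hWd x (ht0.trans hx.1.le))
    rw [eq_div_iff (by linarith), hdis] at hc2
    have hd : dist (z c) (z t) < δ := by
      rw [dist_eq_norm]
      refine (hlip t c ht0 hc1.1.le).trans_lt (lt_of_le_of_lt ?_ hMS)
      exact mul_le_mul_of_nonneg_left (by linarith [hc1.2]) (abs_nonneg _)
    have h1 := hδ' _ (hzK c (ht0.trans hc1.1.le)) _ (hzK t ht0) hd
    rw [Real.dist_eq] at h1
    have h2 := (abs_lt.1 h1).1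
    have h3 := hanti N t hN ht
    nlinarith
  have iter : ∀ k : ℕ, ∃ t, 0 ≤ t ∧ W (z t) ≤ W (z 0) - k * (S * (ε / 2)) := by
    intro k
    induction k with
    | zero => exact ⟨0, le_rfl, by simp⟩
    | succ k ih =>
      obtain ⟨t, ht, h1⟩ := ih
      obtain ⟨t', ht', h2⟩ := step t ht
      refine ⟨t', ht.trans ht', ?_⟩
      push_cast
      linarith
  obtain ⟨k, hk⟩ := exists_nat_gt (W (z 0) / (S * (ε / 2)))
  rw [div_lt_iff₀ (by positivity)] at hk
  obtain ⟨t, ht, h1⟩ := iter k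
  linarith [hWp (z t)]

end Generic

/-- Convergence along all bounded time shifts of the sequence `τ`. -/
def ShiftTendsto (τ : ℕ → ℝ) (S : ℝ) (u : ℝ → ℝ) (c : ℝ) : Prop :=
  ∀ s : ℕ → ℝ, (∀ k, 0 ≤ s k ∧ s k ≤ S) → Tendsto (fun k => u (τ k + s k)) atTop (𝓝 c)

theorem shift_deriv (τ : ℕ → ℝ) (hτ0 : ∀ k, 0 ≤ τ k) (S : ℝ) (u u' : ℝ → ℝ) (v : ℝ)
    (hu : ∀ t, 0 ≤ t → HasDerivAt u (u' t) t) (hv : ShiftTendsto τ S u' v)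
    (s : ℕ → ℝ) (hs : ∀ k, 0 ≤ s k ∧ s k ≤ S) :
    Tendsto (fun k => u (τ k + s k) - u (τ k) - s k * v) atTop (𝓝 0) := by
  have key : ∀ k, ∃ c, (0 ≤ c ∧ c ≤ S) ∧ u (τ k + s k) - u (τ k) = s k * u' (τ k + c) := by
    intro k
    rcases (hs k).1.eq_or_lt with h0 | h0
    · refine ⟨s k, hs k, ?_⟩
      rw [← h0]; simp
    obtain ⟨c, hc1, hc2⟩ := exists_hasDerivAt_eq_slope u u' (show τ k < τ k + s k by linarith)
      (fun x hx => (hu x ((hτ0 k).trans hx.1)).continuousAt.continuousWithinAt)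
      (fun x hx => hu x ((hτ0 k).trans hx.1.le))
    rw [eq_div_iff (by linarith)] at hc2
    refine ⟨c - τ k, ⟨by linarith [hc1.1], by linarith [hc1.2, (hs k).2]⟩, ?_⟩
    rw [← hc2]
    rw [add_sub_cancel]; ring
  choose c hc hcu using key
  have h1 := hv c hc
  have h2 : Tendsto (fun k => S * |u' (τ k + c k) - v|) atTop (𝓝 0) := by
    have := ((h1.sub_const v).abs).const_mul S
    simpa using this
  refine squeeze_zero_norm (fun k => ?_) h2
  rw [hcu k, ← mul_sub, Real.norm_eq_abs, abs_mul, abs_of_nonneg (hs k).1]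
  exact mul_le_mul_of_nonneg_right (hs k).2 (abs_nonneg _)

theorem shift_of_tendsto (τ : ℕ → ℝ) (hτ : Tendsto τ atTop atTop) (S : ℝ) (u : ℝ → ℝ) (v : ℝ)
    (hu : Tendsto u atTop (𝓝 v)) : ShiftTendsto τ S u v := by
  intro s hs
  exact hu.comp (tendsto_atTop_mono (fun k => by linarith [(hs k).1]) hτ)

theorem shift_of_deriv_zero (τ : ℕ → ℝ) (hτ0 : ∀ k, 0 ≤ τ k) (S : ℝ) (u u' : ℝ → ℝ) (c : ℝ)
    (hu : ∀ t, 0 ≤ t → HasDerivAt u (u' t) t) (hv : ShiftTendsto τ S u' 0)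
    (hc : Tendsto (fun k => u (τ k)) atTop (𝓝 c)) : ShiftTendsto τ S u c := by
  intro s hs
  have := (shift_deriv τ hτ0 S u u' 0 hu hv s hs).add hc
  simpa using this

/-- If a function and its derivative both converge along shifts, the latter tends to zero. -/
theorem shift_limit_zero (τ : ℕ → ℝ) (hτ0 : ∀ k, 0 ≤ τ k) (u u' : ℝ → ℝ) (c v : ℝ)
    (hu : ∀ t, 0 ≤ t → HasDerivAt u (u' t) t) (hv : ShiftTendsto τ 1 u' v)
    (hc : ShiftTendsto τ 1 u c) : v = 0 := by
  have h1 := shift_deriv τ hτ0 1 u u' v hu hv (fun _ => 1) (fun _ => by norm_num)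
  have h2 := hc (fun _ => 1) (fun _ => by norm_num)
  have h3 := hc (fun _ => 0) (fun _ => by norm_num)
  simp only [add_zero] at h3
  have h4 := (h2.sub h3).sub_const (1 * v)
  have := tendsto_nhds_unique h1 h4
  linarith

/-- A bounded function whose derivative converges along shifts of all lengths. -/
theorem shift_limit_zero_of_bounded (τ : ℕ → ℝ) (hτ0 : ∀ k, 0 ≤ τ k) (u u' : ℝ → ℝ) (R v : ℝ)
    (hu : ∀ t, 0 ≤ t → HasDerivAt u (u' t) t) (hv : ∀ S, ShiftTendsto τ S u' v)
    (hR : ∀ t, 0 ≤ t → |u t| ≤ R) : v = 0 := by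
  by_contra hv0
  have hvp : 0 < |v| := abs_pos.2 hv0
  have hR0 : 0 ≤ R := (abs_nonneg _).trans (hR 0 le_rfl)
  set S := (2 * R + 2) / |v| with hS
  have hSp : 0 ≤ S := by positivity
  have h1 := shift_deriv τ hτ0 S u u' v hu (hv S) (fun _ => S) (fun _ => ⟨hSp, le_rfl⟩)
  obtain ⟨k, hk⟩ := ((tendsto_order.1 h1.abs).2 1 (by simp)).exists
  have e : S * |v| = 2 * R + 2 := by rw [hS]; field_simp
  have e2 : |S * v| = S * |v| := by rw [abs_mul, abs_of_nonneg hSp]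
  have a1 := hR _ (hτ0 k)
  have a2 := hR (τ k + S) (by linarith [hτ0 k])
  have a3 := abs_sub_abs_le_abs_sub (S * v) (u (τ k + S) - u (τ k))
  rw [abs_sub_comm (S * v)] at a3
  have a4 := abs_sub (u (τ k + S)) (u (τ k))
  linarith

theorem tendsto_of_strictMono {α : Type*} {l : Filter α} (f : ℝ → ℝ) (hf : StrictMono f)
    (u : α → ℝ) (c : ℝ) (h : Tendsto (fun k => f (u k)) l (𝓝 (f c))) : Tendsto u l (𝓝 c) := by
  rw [tendsto_order] at h ⊢
  refine ⟨fun b hb => ?_, fun b hb => ?_⟩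
  · filter_upwards [h.1 _ (hf hb)] with k hk using hf.lt_iff_lt.1 hk
  · filter_upwards [h.2 _ (hf hb)] with k hk using hf.lt_iff_lt.1 hk

section Algebra

variable {n m p : ℕ}

theorem incT_apply (G : OrientedGraph n m) (y : Fin n → ℝ) (k : Fin m) :
    (G.incᵀ.mulVec y) k = y (G.pos k) - y (G.neg k) := by
  have h : ∀ i, G.inc i k * y i
      = (if i = G.pos k then y i else 0) - (if i = G.neg k then y i else 0) := by
    intro i
    have := G.ne_ends k
    simp only [OrientedGraph.inc, Matrix.of_apply]
    by_cases h1 : i = G.pos k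
    · have h2 : i ≠ G.neg k := by rw [h1]; exact this
      simp [h1, this]
    · by_cases h2 : i = G.neg k <;> simp [h1, h2, this.symm]
  simp only [Matrix.mulVec, dotProduct, Matrix.transpose_apply, h, Finset.sum_sub_distrib]
  simp

theorem inc_sum (G : OrientedGraph n m) (l : Fin m → ℝ) : ∑ i, (G.inc.mulVec l) i = 0 := by
  have h1 : (fun _ : Fin n => (1:ℝ)) ⬝ᵥ G.inc.mulVec l = 0 := by
    rw [Matrix.dotProduct_mulVec, ← Matrix.mulVec_transpose]
    have : G.incᵀ.mulVec (fun _ => (1:ℝ)) = 0 := by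
      ext k; rw [incT_apply]; simp
    rw [this]; simp
  simpa [dotProduct] using h1

theorem selT_apply (hpn : p ≤ n) (y : Fin n → ℝ) (j : Fin p) :
    ((selE n p)ᵀ.mulVec y) j = y (Fin.castLE hpn j) := by
  have h : ∀ i : Fin n, selE n p i j * y i = if i = Fin.castLE hpn j then y i else 0 := by
    intro i
    simp [selE, Fin.ext_iff]
  simp only [Matrix.mulVec, dotProduct, Matrix.transpose_apply, h]
  simp

theorem sel_sum (hpn : p ≤ n) (u : Fin p → ℝ) : ∑ i, ((selE n p).mulVec u) i = ∑ j, u j := by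
  have h1 : (fun _ : Fin n => (1:ℝ)) ⬝ᵥ (selE n p).mulVec u = (fun _ : Fin p => (1:ℝ)) ⬝ᵥ u := by
    rw [Matrix.dotProduct_mulVec, ← Matrix.mulVec_transpose]
    congr 1
    ext k; rw [selT_apply hpn]
  simpa [dotProduct] using h1

theorem connected_const (G : OrientedGraph n m) (hG : G.Connected) (y : Fin n → ℝ)
    (hy : ∀ k, y (G.pos k) = y (G.neg k)) (i j : Fin n) : y i = y j := by
  induction hG i j with
  | refl => rfl
  | tail _ hab ih =>
    obtain ⟨k, ⟨h1, h2⟩ | ⟨h1, h2⟩⟩ := hab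
    · rw [ih, ← h1, ← h2, hy]
    · rw [ih, ← h1, ← h2, hy]

/-- The quadratic form of a balanced Laplacian. -/
theorem lap_quad (L : Matrix (Fin p) (Fin p) ℝ) (hL : IsBalancedStronglyConnectedLaplacian L)
    (w : Fin p → ℝ) :
    w ⬝ᵥ L.mulVec w = (1 / 2) * ∑ i, ∑ j, -L i j * (w i - w j) ^ 2 := by
  have hr : ∀ i, ∑ j, L i j = 0 := by
    intro i
    have := congrFun hL.rowsum i
    simpa [Matrix.mulVec, dotProduct] using this
  have hc : ∀ j, ∑ i, L i j = 0 := by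
    intro i
    have := congrFun hL.colsum i
    simpa [Matrix.vecMul, dotProduct] using this
  have e : ∀ i j, -L i j * (w i - w j) ^ 2
      = 2 * (w i * (L i j * w j)) - w i ^ 2 * L i j - w j ^ 2 * L i j := by
    intros; ring
  simp only [e, Finset.sum_sub_distrib, ← Finset.mul_sum, hr]
  have h2 : ∑ i, ∑ j, w j ^ 2 * L i j = 0 := by
    rw [Finset.sum_comm]
    simp only [← Finset.mul_sum, hc]
    simp
  rw [h2]
  simp [Matrix.mulVec, dotProduct]

theorem lap_term_nonneg (L : Matrix (Fin p) (Fin p) ℝ)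
    (hL : IsBalancedStronglyConnectedLaplacian L) (w : Fin p → ℝ) (i j : Fin p) :
    0 ≤ -L i j * (w i - w j) ^ 2 := by
  by_cases h : i = j
  · simp [h]
  · exact mul_nonneg (by linarith [hL.offdiag_nonpos i j h]) (sq_nonneg _)

theorem lap_apply (L : Matrix (Fin p) (Fin p) ℝ) (hL : IsBalancedStronglyConnectedLaplacian L)
    (w : Fin p → ℝ) (i : Fin p) : L.mulVec w i = ∑ j, -L i j * (w i - w j) := by
  have hr : ∑ j, L i j = 0 := by
    have := congrFun hL.rowsum i
    simpa [Matrix.mulVec, dotProduct] using this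
  have e : ∀ j, -L i j * (w i - w j) = L i j * w j - L i j * w i := by intro j; ring
  simp only [e, Finset.sum_sub_distrib, ← Finset.sum_mul, hr]
  simp [Matrix.mulVec, dotProduct]

theorem lap_const (L : Matrix (Fin p) (Fin p) ℝ) (hL : IsBalancedStronglyConnectedLaplacian L)
    (w : Fin p → ℝ) (hw : ∀ i j, -L i j * (w i - w j) ^ 2 = 0) (i j : Fin p) : w i = w j := by
  induction hL.sconn i j with
  | refl => rfl
  | @tail b c _ hab ih =>
    rw [ih]
    have := hw b c
    rcases mul_eq_zero.1 this with h | h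
    · linarith [hab.2]
    · have := pow_eq_zero_iff (two_ne_zero) |>.1 h
      linarith

theorem q_uOpt (q r : Fin p → ℝ) (hq : ∀ i, 0 < q i) (d : Fin n → ℝ) (i : Fin p) :
    q i * uOpt q r d i + r i = lamStar q r d := by
  have := (hq i).ne'
  simp only [uOpt]
  field_simp
  ring

/-- Dissipation identity. -/
theorem dissip (G : OrientedGraph n m) (q r : Fin p → ℝ) (hq : ∀ i, 0 < q i)
    (d : Fin n → ℝ) (L : Matrix (Fin p) (Fin p) ℝ) (hL : IsBalancedStronglyConnectedLaplacian L)
    (lb : Fin m → ℝ) (hlb : G.inc.mulVec lb = (selE n p).mulVec (uOpt q r d) - d)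
    (y : Fin n → ℝ) (F X : Fin m → ℝ) (g φ : Fin p → ℝ) :
    (∑ i, y i * (-(G.inc.mulVec F) + (selE n p).mulVec g - d) i)
    + ((∑ k, (F k - lb k) * (G.incᵀ.mulVec y - (F - X)) k)
    + ((∑ k, (X k - lb k) * (F - X) k)
    + ((∑ i, (g i - uOpt q r d i) * (-((selE n p)ᵀ.mulVec y) - (g - φ)) i)
    + (∑ i, (φ i - uOpt q r d i) * (g - φ -
        (Matrix.diagonal q).mulVec (L.mulVec ((Matrix.diagonal q).mulVec φ + r))) i))))
    = -((∑ k, (F k - X k) ^ 2) + (∑ i, (g i - φ i) ^ 2)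
      + (1 / 2) * ∑ i, ∑ j, -L i j * ((q i * φ i + r i) - (q j * φ j + r j)) ^ 2) := by
  set ub := uOpt q r d with hub
  set w : Fin p → ℝ := fun i => q i * φ i + r i with hw
  have hwe : (Matrix.diagonal q).mulVec φ + r = w := by
    ext i; simp [Matrix.mulVec_diagonal, hw]
  have hquad := lap_quad L hL w
  -- 1ᵀ L w = 0
  have hcol : ∑ i, L.mulVec w i = 0 := by
    have h1 : (fun _ : Fin p => (1:ℝ)) ⬝ᵥ L.mulVec w = 0 := by
      rw [Matrix.dotProduct_mulVec, hL.colsum]; simp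
    simpa [dotProduct] using h1
  have e1 : (∑ i, y i * (-(G.inc.mulVec F) + (selE n p).mulVec g - d) i)
      = -(y ⬝ᵥ G.inc.mulVec (F - lb)) + y ⬝ᵥ (selE n p).mulVec (g - ub) := by
    have : -(G.inc.mulVec F) + (selE n p).mulVec g - d
        = -(G.inc.mulVec (F - lb)) + (selE n p).mulVec (g - ub) := by
      rw [Matrix.mulVec_sub, Matrix.mulVec_sub, hlb]; abel
    rw [this]
    change y ⬝ᵥ (-(G.inc.mulVec (F - lb)) + (selE n p).mulVec (g - ub)) = _
    rw [dotProduct_add, dotProduct_neg]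
  have e2 : (∑ k, (F k - lb k) * (G.incᵀ.mulVec y - (F - X)) k)
      = y ⬝ᵥ G.inc.mulVec (F - lb) - ∑ k, (F k - lb k) * (F k - X k) := by
    have : y ⬝ᵥ G.inc.mulVec (F - lb) = ∑ k, (F k - lb k) * (G.incᵀ.mulVec y) k := by
      rw [Matrix.dotProduct_mulVec, ← Matrix.mulVec_transpose, dotProduct_comm]; rfl
    rw [this, ← Finset.sum_sub_distrib]
    refine Finset.sum_congr rfl fun k _ => ?_
    simp only [Pi.sub_apply]; ring
  have e4 : (∑ i, (g i - ub i) * (-((selE n p)ᵀ.mulVec y) - (g - φ)) i)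
      = - (y ⬝ᵥ (selE n p).mulVec (g - ub)) - ∑ i, (g i - ub i) * (g i - φ i) := by
    have : y ⬝ᵥ (selE n p).mulVec (g - ub) = ∑ k, (g k - ub k) * ((selE n p)ᵀ.mulVec y) k := by
      rw [Matrix.dotProduct_mulVec, ← Matrix.mulVec_transpose, dotProduct_comm]; rfl
    rw [this, ← Finset.sum_neg_distrib, ← Finset.sum_sub_distrib]
    refine Finset.sum_congr rfl fun k _ => ?_
    simp only [Pi.sub_apply, Pi.neg_apply]; ring
  have e5 : (∑ i, (φ i - ub i) * (g - φ -
        (Matrix.diagonal q).mulVec (L.mulVec ((Matrix.diagonal q).mulVec φ + r))) i)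
      = (∑ i, (φ i - ub i) * (g i - φ i)) - w ⬝ᵥ L.mulVec w := by
    have h1 : w ⬝ᵥ L.mulVec w = ∑ i, (w i - lamStar q r d) * L.mulVec w i := by
      simp only [sub_mul, Finset.sum_sub_distrib, ← Finset.mul_sum, hcol]
      simp [dotProduct]
    rw [h1, hwe, ← Finset.sum_sub_distrib]
    refine Finset.sum_congr rfl fun i _ => ?_
    have h2 := q_uOpt q r hq d i
    simp only [Pi.sub_apply, Matrix.mulVec_diagonal]
    rw [← h2, hw, hub]
    ring
  have e3 : (∑ k, (X k - lb k) * (F - X) k) - ∑ k, (F k - lb k) * (F k - X k)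
      = - ∑ k, (F k - X k) ^ 2 := by
    rw [← Finset.sum_sub_distrib, ← Finset.sum_neg_distrib]
    refine Finset.sum_congr rfl fun i _ => ?_
    simp only [Pi.sub_apply]; ring
  have e6 : (∑ i, (φ i - ub i) * (g i - φ i)) - ∑ i, (g i - ub i) * (g i - φ i)
      = - ∑ k, (g k - φ k) ^ 2 := by
    rw [← Finset.sum_sub_distrib, ← Finset.sum_neg_distrib]
    refine Finset.sum_congr rfl fun i _ => ?_
    ring
  rw [e1, e2, e4, e5]
  simp only [hw] at hquad ⊢
  linarith

end Algebra

/-- Index type of the full state. -/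
abbrev SIdx (n m p : ℕ) := Fin n ⊕ Fin m ⊕ Fin m ⊕ Fin p ⊕ Fin p

/-- Stack five blocks. -/
def stk {α : Type*} {n m p : ℕ} (x : Fin n → α) (μ ξ : Fin m → α) (θ φ : Fin p → α) :
    SIdx n m p → α :=
  Sum.elim x (Sum.elim μ (Sum.elim ξ (Sum.elim θ φ)))

/-- The vector field (before time scaling), as a function of the blocks. -/
noncomputable def vfb {n m p : ℕ} (G : OrientedGraph n m) (h : Fin n → ℝ → ℝ)
    (f : Fin m → ℝ → ℝ) (g : Fin p → ℝ → ℝ) (q r : Fin p → ℝ) (d ybar : Fin n → ℝ)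
    (L : Matrix (Fin p) (Fin p) ℝ)
    (x : Fin n → ℝ) (μ ξ : Fin m → ℝ) (θ φ : Fin p → ℝ) : SIdx n m p → ℝ :=
  stk (-(G.inc.mulVec (cw f μ)) + (selE n p).mulVec (cw g θ) - d)
    ((G.inc)ᵀ.mulVec (cw h x - ybar) - (cw f μ - ξ))
    (cw f μ - ξ)
    (-((selE n p)ᵀ.mulVec (cw h x - ybar)) - (cw g θ - φ))
    (cw g θ - φ -
        (Matrix.diagonal q).mulVec (L.mulVec ((Matrix.diagonal q).mulVec φ + r)))

/-- The vector field on the stacked state. -/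
noncomputable def vf {n m p : ℕ} (G : OrientedGraph n m) (h : Fin n → ℝ → ℝ)
    (f : Fin m → ℝ → ℝ) (g : Fin p → ℝ → ℝ) (q r : Fin p → ℝ) (d ybar : Fin n → ℝ)
    (L : Matrix (Fin p) (Fin p) ℝ) (y : SIdx n m p → ℝ) : SIdx n m p → ℝ :=
  vfb G h f g q r d ybar L (fun i => y (Sum.inl i)) (fun i => y (Sum.inr (Sum.inl i)))
    (fun i => y (Sum.inr (Sum.inr (Sum.inl i))))
    (fun i => y (Sum.inr (Sum.inr (Sum.inr (Sum.inl i)))))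
    (fun i => y (Sum.inr (Sum.inr (Sum.inr (Sum.inr i)))))

theorem continuous_cw {k : ℕ} {X : Type*} [TopologicalSpace X] (f : Fin k → ℝ → ℝ)
    (hf : ∀ i, Continuous (f i)) (u : X → Fin k → ℝ) (hu : Continuous u) :
    Continuous (fun y => cw f (u y)) :=
  continuous_pi fun i => (hf i).comp ((continuous_apply i).comp hu)

theorem vf_continuous {n m p : ℕ} (G : OrientedGraph n m) (h : Fin n → ℝ → ℝ)
    (f : Fin m → ℝ → ℝ) (g : Fin p → ℝ → ℝ) (q r : Fin p → ℝ) (d ybar : Fin n → ℝ)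
    (L : Matrix (Fin p) (Fin p) ℝ) (hh : ∀ i, Continuous (h i)) (hf : ∀ i, Continuous (f i))
    (hg : ∀ i, Continuous (g i)) : Continuous (vf G h f g q r d ybar L) := by
  have cx : Continuous (fun y : SIdx n m p → ℝ => cw h (fun i => y (Sum.inl i))) :=
    continuous_cw h hh _ (by fun_prop)
  have cm : Continuous (fun y : SIdx n m p → ℝ => cw f (fun i => y (Sum.inr (Sum.inl i)))) :=
    continuous_cw f hf _ (by fun_prop)
  have ct : Continuous (fun y : SIdx n m p → ℝ =>
      cw g (fun i => y (Sum.inr (Sum.inr (Sum.inr (Sum.inl i)))))) :=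
    continuous_cw g hg _ (by fun_prop)
  refine continuous_pi fun j => ?_
  rcases j with i | i | i | i | i
  · have : Continuous (fun y : SIdx n m p → ℝ =>
        -(G.inc.mulVec (cw f (fun i => y (Sum.inr (Sum.inl i)))))
        + (selE n p).mulVec (cw g (fun i => y (Sum.inr (Sum.inr (Sum.inr (Sum.inl i))))))
        - d) := by fun_prop
    exact (continuous_apply i).comp this
  · have : Continuous (fun y : SIdx n m p → ℝ =>
        (G.inc)ᵀ.mulVec (cw h (fun i => y (Sum.inl i)) - ybar)
        - (cw f (fun i => y (Sum.inr (Sum.inl i)))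
          - fun i => y (Sum.inr (Sum.inr (Sum.inl i))))) := by fun_prop
    exact (continuous_apply i).comp this
  · have : Continuous (fun y : SIdx n m p → ℝ =>
        (cw f (fun i => y (Sum.inr (Sum.inl i)))
          - fun i => y (Sum.inr (Sum.inr (Sum.inl i))))) := by fun_prop
    exact (continuous_apply i).comp this
  · have : Continuous (fun y : SIdx n m p → ℝ =>
        -((selE n p)ᵀ.mulVec (cw h (fun i => y (Sum.inl i)) - ybar))
        - (cw g (fun i => y (Sum.inr (Sum.inr (Sum.inr (Sum.inl i)))))
          - fun i => y (Sum.inr (Sum.inr (Sum.inr (Sum.inr i)))))) := by fun_prop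
    exact (continuous_apply i).comp this
  · have : Continuous (fun y : SIdx n m p → ℝ =>
        (cw g (fun i => y (Sum.inr (Sum.inr (Sum.inr (Sum.inl i)))))
          - fun i => y (Sum.inr (Sum.inr (Sum.inr (Sum.inr i)))))
        - (Matrix.diagonal q).mulVec (L.mulVec ((Matrix.diagonal q).mulVec
            (fun i => y (Sum.inr (Sum.inr (Sum.inr (Sum.inr i))))) + r))) := by fun_prop
    exact (continuous_apply i).comp this

/-- The dissipation rate. -/
noncomputable def dis {n m p : ℕ} (f : Fin m → ℝ → ℝ) (g : Fin p → ℝ → ℝ) (q r : Fin p → ℝ)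
    (L : Matrix (Fin p) (Fin p) ℝ) (y : SIdx n m p → ℝ) : ℝ :=
  (∑ k, (f k (y (Sum.inr (Sum.inl k))) - y (Sum.inr (Sum.inr (Sum.inl k)))) ^ 2)
  + (∑ i, (g i (y (Sum.inr (Sum.inr (Sum.inr (Sum.inl i)))))
      - y (Sum.inr (Sum.inr (Sum.inr (Sum.inr i))))) ^ 2)
  + (1 / 2) * ∑ i, ∑ j, -L i j *
      ((q i * y (Sum.inr (Sum.inr (Sum.inr (Sum.inr i)))) + r i)
        - (q j * y (Sum.inr (Sum.inr (Sum.inr (Sum.inr j)))) + r j)) ^ 2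

theorem dis_continuous {n m p : ℕ} (f : Fin m → ℝ → ℝ) (g : Fin p → ℝ → ℝ) (q r : Fin p → ℝ)
    (L : Matrix (Fin p) (Fin p) ℝ) (hf : ∀ i, Continuous (f i)) (hg : ∀ i, Continuous (g i)) :
    Continuous (dis (n := n) f g q r L) := by
  unfold dis
  fun_prop

/-- The dissipation identity on the stacked state. -/
theorem dissip_vf {n m p : ℕ} (G : OrientedGraph n m) (h : Fin n → ℝ → ℝ)
    (f : Fin m → ℝ → ℝ) (g : Fin p → ℝ → ℝ) (q r : Fin p → ℝ) (hq : ∀ i, 0 < q i)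
    (d ybar : Fin n → ℝ) (L : Matrix (Fin p) (Fin p) ℝ)
    (hL : IsBalancedStronglyConnectedLaplacian L)
    (xs : Fin n → ℝ) (ms xis : Fin m → ℝ) (ths phs : Fin p → ℝ)
    (hxs : cw h xs = ybar) (hms : G.inc.mulVec (cw f ms) = (selE n p).mulVec (uOpt q r d) - d)
    (hxis : xis = cw f ms) (hths : cw g ths = uOpt q r d) (hphs : phs = uOpt q r d)
    (y : SIdx n m p → ℝ) :
    ∑ j, (stk h f (fun _ s => s) g (fun _ s => s) j (y j)
      - stk h f (fun _ s => s) g (fun _ s => s) j (stk xs ms xis ths phs j))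
        * vf G h f g q r d ybar L y j = - dis f g q r L y := by
  have key := dissip G q r hq d L hL (cw f ms) hms
    (cw h (fun i => y (Sum.inl i)) - ybar) (cw f (fun i => y (Sum.inr (Sum.inl i))))
    (fun i => y (Sum.inr (Sum.inr (Sum.inl i))))
    (cw g (fun i => y (Sum.inr (Sum.inr (Sum.inr (Sum.inl i))))))
    (fun i => y (Sum.inr (Sum.inr (Sum.inr (Sum.inr i)))))
  have hxs' : ∀ i, h i (xs i) = ybar i := fun i => congrFun hxs i
  have hths' : ∀ i, g i (ths i) = uOpt q r d i := fun i => congrFun hths i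
  subst hxis hphs
  simp only [Fintype.sum_sum_type]
  simp only [stk, vf, vfb, Sum.elim_inl, Sum.elim_inr, hxs', hths']
  exact key

/-- **Theorem 1.** Every solution of the closed-loop system respects the
flow and input constraints for all `t ≥ 0` and converges to a point achieving output
regulation `h(x*) = ȳ` and the optimal input `g(θ*) = ū`. -/
theorem main_convergence {n m p : ℕ} (hp : 0 < p) (hpn : p ≤ n)
    (G : OrientedGraph n m) (hG : G.Connected)
    (h : Fin n → ℝ → ℝ) (hh : ∀ i, ContDiff ℝ 1 (h i) ∧ StrictMono (h i))
    (f : Fin m → ℝ → ℝ) (hf : ∀ k, ContDiff ℝ 1 (f k) ∧ StrictMono (f k))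
    (g : Fin p → ℝ → ℝ) (hg : ∀ i, ContDiff ℝ 1 (g i) ∧ StrictMono (g i))
    (lamlo lamhi : Fin m → ℝ) (hfr : ∀ k, Set.range (f k) = Set.Ioo (lamlo k) (lamhi k))
    (ulo uhi : Fin p → ℝ) (hgr : ∀ i, Set.range (g i) = Set.Ioo (ulo i) (uhi i))
    (q r : Fin p → ℝ) (hq : ∀ i, 0 < q i) (d ybar : Fin n → ℝ)
    (hy : ∀ i, ybar i ∈ Set.range (h i))
    (hu : ∀ i, uOpt q r d i ∈ Set.range (g i))
    (hlam : ∃ lb : Fin m → ℝ,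
      G.inc.mulVec lb = (selE n p).mulVec (uOpt q r d) - d ∧
      ∀ k, lb k ∈ Set.range (f k))
    (L : Matrix (Fin p) (Fin p) ℝ) (hL : IsBalancedStronglyConnectedLaplacian L)
    (Tx : Fin n → ℝ) (Tm Txi : Fin m → ℝ) (Tth Tph : Fin p → ℝ)
    (hTx : ∀ i, 0 < Tx i) (hTm : ∀ k, 0 < Tm k) (hTxi : ∀ k, 0 < Txi k)
    (hTth : ∀ i, 0 < Tth i) (hTph : ∀ i, 0 < Tph i)
    -- a solution of the closed-loop system on [0, ∞)
    (x : ℝ → Fin n → ℝ) (μ ξ : ℝ → Fin m → ℝ) (θ φ : ℝ → Fin p → ℝ)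
    (hxode : ∀ t, 0 ≤ t → ∀ i, HasDerivAt (fun s => x s i)
      (((-(G.inc.mulVec (cw f (μ t))) + (selE n p).mulVec (cw g (θ t)) - d) i) / Tx i) t)
    (hμode : ∀ t, 0 ≤ t → ∀ k, HasDerivAt (fun s => μ s k)
      ((((G.inc)ᵀ.mulVec (cw h (x t) - ybar) - (cw f (μ t) - ξ t)) k) / Tm k) t)
    (hξode : ∀ t, 0 ≤ t → ∀ k, HasDerivAt (fun s => ξ s k)
      (((cw f (μ t) - ξ t) k) / Txi k) t)
    (hθode : ∀ t, 0 ≤ t → ∀ i, HasDerivAt (fun s => θ s i)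
      (((-((selE n p)ᵀ.mulVec (cw h (x t) - ybar)) - (cw g (θ t) - φ t)) i) / Tth i) t)
    (hφode : ∀ t, 0 ≤ t → ∀ i, HasDerivAt (fun s => φ s i)
      (((cw g (θ t) - φ t -
        (Matrix.diagonal q).mulVec (L.mulVec ((Matrix.diagonal q).mulVec (φ t) + r))) i)
        / Tph i) t) :
    -- (a) constraints hold for all t ≥ 0
    (∀ t, 0 ≤ t →
      (∀ k, lamlo k < f k (μ t k) ∧ f k (μ t k) < lamhi k) ∧
      (∀ i, ulo i < g i (θ t i) ∧ g i (θ t i) < uhi i)) ∧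
    -- (b) convergence to an optimal steady state
    (∃ (xs : Fin n → ℝ) (ms xis : Fin m → ℝ) (ths phs : Fin p → ℝ),
      Tendsto x atTop (𝓝 xs) ∧ Tendsto μ atTop (𝓝 ms) ∧ Tendsto ξ atTop (𝓝 xis) ∧
      Tendsto θ atTop (𝓝 ths) ∧ Tendsto φ atTop (𝓝 phs) ∧
      cw h xs = ybar ∧ cw g ths = uOpt q r d ∧ xis = cw f ms ∧
      G.inc.mulVec (cw f ms) = (selE n p).mulVec (uOpt q r d) - d) := by
  have hhc : ∀ i, Continuous (h i) := fun i => (hh i).1.continuous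
  have hfc : ∀ i, Continuous (f i) := fun i => (hf i).1.continuous
  have hgc : ∀ i, Continuous (g i) := fun i => (hg i).1.continuous
  refine ⟨fun t _ => ⟨fun k => ?_, fun i => ?_⟩, ?_⟩
  · have : f k (μ t k) ∈ Set.Ioo (lamlo k) (lamhi k) := hfr k ▸ Set.mem_range_self _
    exact this
  · have : g i (θ t i) ∈ Set.Ioo (ulo i) (uhi i) := hgr i ▸ Set.mem_range_self _
    exact this
  obtain ⟨lb, hlb, hlbr⟩ := hlam
  choose xb hxb using hy
  choose mb hmb using hlbr
  choose thb hthb using hu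
  have hmb' : cw f mb = lb := funext hmb
  -- the stacked system
  set zz : ℝ → SIdx n m p → ℝ := fun t => stk (x t) (μ t) (ξ t) (θ t) (φ t) with hzz
  set a : SIdx n m p → ℝ → ℝ := stk h f (fun _ s => s) g (fun _ s => s) with haa
  set T : SIdx n m p → ℝ := stk Tx Tm Txi Tth Tph with hTT
  have hT : ∀ j, 0 < T j := by
    rintro (i | i | i | i | i)
    exacts [hTx i, hTm i, hTxi i, hTth i, hTph i]
  have hac : ∀ j, Continuous (a j) := by
    rintro (i | i | i | i | i)
    exacts [hhc i, hfc i, continuous_id, hgc i, continuous_id]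
  have ham : ∀ j, StrictMono (a j) := by
    rintro (i | i | i | i | i)
    exacts [(hh i).2, (hf i).2, strictMono_id, (hg i).2, strictMono_id]
  have hz : ∀ t, 0 ≤ t → ∀ j, HasDerivAt (fun s => zz s j)
      (vf G h f g q r d ybar L (zz t) j / T j) t := by
    rintro t ht (i | i | i | i | i)
    exacts [hxode t ht i, hμode t ht i, hξode t ht i, hθode t ht i, hφode t ht i]
  have hdisnn : ∀ y : SIdx n m p → ℝ, 0 ≤ dis f g q r L y := by
    intro y
    unfold dis
    have h3 : ∀ w : Fin p → ℝ, 0 ≤ ∑ i, ∑ j, -L i j * (w i - w j) ^ 2 := fun w =>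
      Finset.sum_nonneg fun i _ => Finset.sum_nonneg fun j _ => lap_term_nonneg L hL w i j
    have := h3 (fun i => q i * y (Sum.inr (Sum.inr (Sum.inr (Sum.inr i)))) + r i)
    positivity
  have hvfc := vf_continuous G h f g q r d ybar L hhc hfc hgc
  have hdis := dissip_vf G h f g q r hq d ybar L hL xb mb (cw f mb) thb (uOpt q r d)
    (funext hxb) (by rw [hmb', hlb]) rfl (funext hthb) rfl
  obtain ⟨R, hR⟩ := gen_bounded a hac ham T hT (fun t => vf G h f g q r d ybar L (zz t)) zz hz _
    (fun t _ => by rw [hdis]; linarith [hdisnn (zz t)])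
  have hD := gen_barbalat a hac ham T hT (vf G h f g q r d ybar L) hvfc zz hz _
    (dis f g q r L) (dis_continuous f g q r L hfc hgc) hdisnn hdis
  -- componentwise consequences of vanishing dissipation
  set w : ℝ → Fin p → ℝ := fun t i => q i * φ t i + r i with hw
  have hDeq : ∀ t, dis f g q r L (zz t) = (∑ k, (f k (μ t k) - ξ t k) ^ 2)
      + (∑ i, (g i (θ t i) - φ t i) ^ 2)
      + (1 / 2) * ∑ i, ∑ j, -L i j * (w t i - w t j) ^ 2 := fun t => rfl
  have n1 : ∀ t, 0 ≤ ∑ k, (f k (μ t k) - ξ t k) ^ 2 := fun t => by positivity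
  have n2 : ∀ t, 0 ≤ ∑ i, (g i (θ t i) - φ t i) ^ 2 := fun t => by positivity
  have n3 : ∀ t, 0 ≤ ∑ i, ∑ j, -L i j * (w t i - w t j) ^ 2 := fun t =>
    Finset.sum_nonneg fun i _ => Finset.sum_nonneg fun j _ => lap_term_nonneg L hL (w t) i j
  have sqz : ∀ u : ℝ → ℝ, Tendsto (fun t => u t ^ 2) atTop (𝓝 0) → Tendsto u atTop (𝓝 0) := by
    intro u hu
    have h1 := (Real.continuous_sqrt.tendsto 0).comp hu
    simp only [Real.sqrt_zero] at h1
    have h2 : (Real.sqrt ∘ fun t => u t ^ 2) = fun t => |u t| := by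
      ext t; simp [Real.sqrt_sq_eq_abs]
    rw [h2] at h1
    exact (tendsto_zero_iff_abs_tendsto_zero u).2 h1
  have hfξ : ∀ k, Tendsto (fun t => f k (μ t k) - ξ t k) atTop (𝓝 0) := by
    intro k
    refine sqz _ (squeeze_zero (fun t => sq_nonneg _) (fun t => ?_) hD)
    have h1 := Finset.single_le_sum (f := fun k => (f k (μ t k) - ξ t k) ^ 2)
      (fun k _ => sq_nonneg _) (Finset.mem_univ k)
    rw [hDeq]
    linarith [n1 t, n2 t, n3 t]
  have hgφ : ∀ k, Tendsto (fun t => g k (θ t k) - φ t k) atTop (𝓝 0) := by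
    intro k
    refine sqz _ (squeeze_zero (fun t => sq_nonneg _) (fun t => ?_) hD)
    have h1 := Finset.single_le_sum (f := fun k => (g k (θ t k) - φ t k) ^ 2)
      (fun k _ => sq_nonneg _) (Finset.mem_univ k)
    rw [hDeq]
    linarith [n1 t, n2 t, n3 t]
  have hLw : ∀ i j, Tendsto (fun t => -L i j * (w t i - w t j) ^ 2) atTop (𝓝 0) := by
    intro i j
    have hD2 : Tendsto (fun t => 2 * dis f g q r L (zz t)) atTop (𝓝 0) := by
      simpa using hD.const_mul 2
    refine squeeze_zero (fun t => lap_term_nonneg L hL (w t) i j) (fun t => ?_) hD2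
    have h1 := Finset.single_le_sum (f := fun j => -L i j * (w t i - w t j) ^ 2)
      (fun j _ => lap_term_nonneg L hL (w t) i j) (Finset.mem_univ j)
    have h2 := Finset.single_le_sum (f := fun i => ∑ j, -L i j * (w t i - w t j) ^ 2)
      (fun i _ => Finset.sum_nonneg fun j _ => lap_term_nonneg L hL (w t) i j)
      (Finset.mem_univ i)
    rw [hDeq]
    linarith [n1 t, n2 t, n3 t]
  have hLw1 : ∀ i j, Tendsto (fun t => -L i j * (w t i - w t j)) atTop (𝓝 0) := by
    intro i j
    refine sqz _ ?_
    have := (hLw i j).const_mul (-L i j)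
    rw [mul_zero] at this
    refine this.congr fun t => ?_
    ring
  -- the derivatives of ξ and φ vanish asymptotically
  have hξ0 : ∀ k, Tendsto (fun t => ((cw f (μ t) - ξ t) k) / Txi k) atTop (𝓝 0) := by
    intro k
    have := (hfξ k).div_const (Txi k)
    rw [zero_div] at this
    exact this
  have hφ0 : ∀ i, Tendsto (fun t => ((cw g (θ t) - φ t -
        (Matrix.diagonal q).mulVec (L.mulVec ((Matrix.diagonal q).mulVec (φ t) + r))) i)
        / Tph i) atTop (𝓝 0) := by
    intro i
    have h1 : Tendsto (fun t => ∑ j, -L i j * (w t i - w t j)) atTop (𝓝 0) := by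
      have := tendsto_finsetSum (Finset.univ : Finset (Fin p)) (fun j _ => hLw1 i j)
      simpa using this
    have h2 := ((hgφ i).sub (h1.const_mul (q i))).div_const (Tph i)
    simp only [mul_zero, sub_zero, zero_div] at h2
    refine h2.congr fun t => ?_
    have hwe : (Matrix.diagonal q).mulVec (φ t) + r = w t := by
      ext i; simp [Matrix.mulVec_diagonal, hw]
    rw [hwe]
    simp only [Pi.sub_apply, Matrix.mulVec_diagonal, lap_apply L hL, cw]
  -- a limit point
  have hzK : ∀ k : ℕ, zz k ∈ Metric.closedBall (0 : SIdx n m p → ℝ) |R| := by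
    intro k
    rw [mem_closedBall_zero_iff, pi_norm_le_iff_of_nonneg (abs_nonneg R)]
    intro j
    exact (hR k (Nat.cast_nonneg k) j).trans (le_abs_self R)
  obtain ⟨zs, -, σ, hσ, hlim⟩ := (isCompact_closedBall (0 : SIdx n m p → ℝ) |R|).tendsto_subseq hzK
  set τ : ℕ → ℝ := fun k => (σ k : ℝ) with hτ
  have hτ0 : ∀ k, 0 ≤ τ k := fun k => Nat.cast_nonneg _
  have hτt : Tendsto τ atTop atTop := tendsto_natCast_atTop_atTop.comp hσ.tendsto_atTop
  have hlim' : Tendsto (fun k => zz (τ k)) atTop (𝓝 zs) := hlim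
  obtain ⟨xs, ms, xis, ths, phs, rfl⟩ : ∃ xs ms xis ths phs, zs = stk xs ms xis ths phs := by
    refine ⟨fun i => zs (Sum.inl i), fun i => zs (Sum.inr (Sum.inl i)),
      fun i => zs (Sum.inr (Sum.inr (Sum.inl i))),
      fun i => zs (Sum.inr (Sum.inr (Sum.inr (Sum.inl i)))),
      fun i => zs (Sum.inr (Sum.inr (Sum.inr (Sum.inr i)))), ?_⟩
    funext j
    rcases j with i | i | i | i | i <;> rfl
  have hlimj := tendsto_pi_nhds.1 hlim'
  have lx : ∀ i, Tendsto (fun k => x (τ k) i) atTop (𝓝 (xs i)) := fun i => hlimj (Sum.inl i)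
  have lm : ∀ i, Tendsto (fun k => μ (τ k) i) atTop (𝓝 (ms i)) :=
    fun i => hlimj (Sum.inr (Sum.inl i))
  have lxi : ∀ i, Tendsto (fun k => ξ (τ k) i) atTop (𝓝 (xis i)) :=
    fun i => hlimj (Sum.inr (Sum.inr (Sum.inl i)))
  have lth : ∀ i, Tendsto (fun k => θ (τ k) i) atTop (𝓝 (ths i)) :=
    fun i => hlimj (Sum.inr (Sum.inr (Sum.inr (Sum.inl i))))
  have lph : ∀ i, Tendsto (fun k => φ (τ k) i) atTop (𝓝 (phs i)) :=
    fun i => hlimj (Sum.inr (Sum.inr (Sum.inr (Sum.inr i))))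
  have exi : ∀ k, f k (ms k) = xis k := by
    intro k
    have h1 := (((hfc k).tendsto _).comp (lm k)).sub (lxi k)
    have h2 := tendsto_nhds_unique h1 ((hfξ k).comp hτt)
    linarith
  have eph : ∀ k, g k (ths k) = phs k := by
    intro k
    have h1 := (((hgc k).tendsto _).comp (lth k)).sub (lph k)
    have h2 := tendsto_nhds_unique h1 ((hgφ k).comp hτt)
    linarith
  have ewc : ∀ i j, q i * phs i + r i = q j * phs j + r j := by
    refine lap_const L hL (fun i => q i * phs i + r i) ?_
    intro i j
    have h0 : ∀ i, Tendsto (fun k => w (τ k) i) atTop (𝓝 (q i * phs i + r i)) := fun i =>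
      ((lph i).const_mul (q i)).add_const (r i)
    have h1 := (((h0 i).sub (h0 j)).pow 2).const_mul (-L i j)
    exact tendsto_nhds_unique h1 ((hLw i j).comp hτt)
  -- convergence along shifts
  have sxi : ∀ S k, ShiftTendsto τ S (fun t => ξ t k) (xis k) := fun S k =>
    shift_of_deriv_zero τ hτ0 S _ _ _ (fun t ht => hξode t ht k)
      (shift_of_tendsto τ hτt S _ _ (hξ0 k)) (lxi k)
  have sph : ∀ S k, ShiftTendsto τ S (fun t => φ t k) (phs k) := fun S k =>
    shift_of_deriv_zero τ hτ0 S _ _ _ (fun t ht => hφode t ht k)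
      (shift_of_tendsto τ hτt S _ _ (hφ0 k)) (lph k)
  have sm : ∀ S k, ShiftTendsto τ S (fun t => μ t k) (ms k) := by
    intro S k s hs
    refine tendsto_of_strictMono (f k) (hf k).2 _ _ ?_
    have := (shift_of_tendsto τ hτt S _ _ (hfξ k) s hs).add (sxi S k s hs)
    rw [exi]
    simpa using this
  have sth : ∀ S k, ShiftTendsto τ S (fun t => θ t k) (ths k) := by
    intro S k s hs
    refine tendsto_of_strictMono (g k) (hg k).2 _ _ ?_
    have := (shift_of_tendsto τ hτt S _ _ (hgφ k) s hs).add (sph S k s hs)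
    rw [eph]
    simpa using this
  have hcwm : ∀ S, ∀ s : ℕ → ℝ, (∀ k, 0 ≤ s k ∧ s k ≤ S) →
      Tendsto (fun k => cw f (μ (τ k + s k))) atTop (𝓝 (cw f ms)) := fun S s hs =>
    tendsto_pi_nhds.2 fun i => ((hfc i).tendsto _).comp (sm S i s hs)
  have hcwth : ∀ S, ∀ s : ℕ → ℝ, (∀ k, 0 ≤ s k ∧ s k ≤ S) →
      Tendsto (fun k => cw g (θ (τ k + s k))) atTop (𝓝 (cw g ths)) := fun S s hs =>
    tendsto_pi_nhds.2 fun i => ((hgc i).tendsto _).comp (sth S i s hs)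
  have mvt : ∀ {a b : ℕ} (A : Matrix (Fin a) (Fin b) ℝ) (u : ℕ → Fin b → ℝ) (c : Fin b → ℝ),
      Tendsto u atTop (𝓝 c) → Tendsto (fun k => A.mulVec (u k)) atTop (𝓝 (A.mulVec c)) := by
    intro a b A u c hu
    have : Continuous (fun v : Fin b → ℝ => A.mulVec v) := by fun_prop
    exact (this.tendsto c).comp hu
  have sx' : ∀ S i, ShiftTendsto τ S (fun t => ((-(G.inc.mulVec (cw f (μ t)))
      + (selE n p).mulVec (cw g (θ t)) - d) i) / Tx i)
      (((-(G.inc.mulVec (cw f ms)) + (selE n p).mulVec (cw g ths) - d) i) / Tx i) := by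
    intro S i s hs
    have h1 := (((mvt G.inc _ _ (hcwm S s hs)).neg.add
      (mvt (selE n p) _ _ (hcwth S s hs))).sub_const d)
    exact (tendsto_pi_nhds.1 h1 i).div_const (Tx i)
  have ex0 : ∀ i, ((-(G.inc.mulVec (cw f ms)) + (selE n p).mulVec (cw g ths) - d) i) / Tx i = 0 :=
    fun i => shift_limit_zero_of_bounded τ hτ0 _ _ R _ (fun t ht => hxode t ht i)
      (fun S => sx' S i) (fun t ht => hR t ht (Sum.inl i))
  have ex0' : ∀ i, (-(G.inc.mulVec (cw f ms)) + (selE n p).mulVec (cw g ths) - d) i = 0 := by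
    intro i
    rcases div_eq_zero_iff.1 (ex0 i) with h1 | h1
    · exact h1
    · exact absurd h1 (hTx i).ne'
  have sx : ∀ S i, ShiftTendsto τ S (fun t => x t i) (xs i) := by
    intro S i
    refine shift_of_deriv_zero τ hτ0 S _ _ _ (fun t ht => hxode t ht i) ?_ (lx i)
    have := sx' S i
    rw [ex0 i] at this
    exact this
  have hcwx : ∀ s : ℕ → ℝ, (∀ k, 0 ≤ s k ∧ s k ≤ 1) →
      Tendsto (fun k => cw h (x (τ k + s k))) atTop (𝓝 (cw h xs)) := fun s hs =>
    tendsto_pi_nhds.2 fun i => ((hhc i).tendsto _).comp (sx 1 i s hs)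
  have em0 : ∀ k, (G.incᵀ.mulVec (cw h xs - ybar)) k = 0 := by
    intro k
    have h1 : ShiftTendsto τ 1 (fun t => (((G.inc)ᵀ.mulVec (cw h (x t) - ybar)
        - (cw f (μ t) - ξ t)) k) / Tm k) (((G.incᵀ.mulVec (cw h xs - ybar)) k - 0) / Tm k) := by
      intro s hs
      have h2 := tendsto_pi_nhds.1 (mvt G.incᵀ _ _ ((hcwx s hs).sub_const ybar)) k
      exact (h2.sub (shift_of_tendsto τ hτt 1 _ _ (hfξ k) s hs)).div_const (Tm k)
    have h3 := shift_limit_zero τ hτ0 _ _ _ _ (fun t ht => hμode t ht k) h1 (sm 1 k)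
    rcases div_eq_zero_iff.1 h3 with h4 | h4
    · linarith
    · exact absurd h4 (hTm k).ne'
  have eth0 : ∀ k, ((selE n p)ᵀ.mulVec (cw h xs - ybar)) k = 0 := by
    intro k
    have h1 : ShiftTendsto τ 1 (fun t => ((-((selE n p)ᵀ.mulVec (cw h (x t) - ybar))
        - (cw g (θ t) - φ t)) k) / Tth k)
        ((-((selE n p)ᵀ.mulVec (cw h xs - ybar)) k - 0) / Tth k) := by
      intro s hs
      have h2 := tendsto_pi_nhds.1 (mvt (selE n p)ᵀ _ _ ((hcwx s hs).sub_const ybar)) k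
      exact (h2.neg.sub (shift_of_tendsto τ hτt 1 _ _ (hgφ k) s hs)).div_const (Tth k)
    have h3 := shift_limit_zero τ hτ0 _ _ _ _ (fun t ht => hθode t ht k) h1 (sth 1 k)
    rcases div_eq_zero_iff.1 h3 with h4 | h4
    · linarith
    · exact absurd h4 (hTth k).ne'
  have hxs : cw h xs = ybar := by
    have h1 : ∀ i j, (cw h xs - ybar) i = (cw h xs - ybar) j :=
      connected_const G hG _ fun k => by
        have := em0 k
        rw [incT_apply] at this
        linarith
    have h2 := eth0 ⟨0, hp⟩
    rw [selT_apply hpn] at h2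
    funext i
    have := (h1 i _).trans h2
    simp only [Pi.sub_apply] at this
    linarith
  have hgth : cw g ths = phs := funext eph
  have hphs : phs = uOpt q r d := by
    have s1 : ∑ j, phs j = ∑ i, d i := by
      have : ∑ i, (-(G.inc.mulVec (cw f ms)) + (selE n p).mulVec (cw g ths) - d) i = 0 :=
        Finset.sum_eq_zero fun i _ => ex0' i
      simp only [Pi.sub_apply, Pi.add_apply, Pi.neg_apply, Finset.sum_sub_distrib,
        Finset.sum_add_distrib, Finset.sum_neg_distrib, inc_sum, sel_sum hpn, hgth] at this
      linarith
    have s2 : ∑ j, uOpt q r d j = ∑ i, d i := by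
      have : ∑ i, (G.inc.mulVec lb) i = ∑ i, ((selE n p).mulVec (uOpt q r d) - d) i := by
        rw [hlb]
      simp only [Pi.sub_apply, Finset.sum_sub_distrib, inc_sum, sel_sum hpn] at this
      linarith
    have s3 : ∀ i, phs i - uOpt q r d i
        = (q ⟨0, hp⟩ * phs ⟨0, hp⟩ + r ⟨0, hp⟩ - lamStar q r d) * (q i)⁻¹ := by
      intro i
      have h1 := ewc i ⟨0, hp⟩
      have h2 := q_uOpt q r hq d i
      rw [← h1, ← h2]
      have := (hq i).ne'
      field_simp
      ring
    have s4 : (q ⟨0, hp⟩ * phs ⟨0, hp⟩ + r ⟨0, hp⟩ - lamStar q r d) * ∑ i, (q i)⁻¹ = 0 := by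
      rw [Finset.mul_sum, ← Finset.sum_congr rfl fun i _ => s3 i, Finset.sum_sub_distrib, s1, s2,
        sub_self]
    have s5 : 0 < ∑ i, (q i)⁻¹ :=
      Finset.sum_pos (fun i _ => inv_pos.2 (hq i)) ⟨⟨0, hp⟩, Finset.mem_univ _⟩
    have s6 := (mul_eq_zero.1 s4).resolve_right s5.ne'
    funext i
    have := s3 i
    rw [s6, zero_mul] at this
    linarith
  have hths : cw g ths = uOpt q r d := hgth.trans hphs
  have hxis : xis = cw f ms := funext fun k => (exi k).symm
  have hms : G.inc.mulVec (cw f ms) = (selE n p).mulVec (uOpt q r d) - d := by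
    funext i
    have := ex0' i
    rw [hths] at this
    simp only [Pi.sub_apply, Pi.add_apply, Pi.neg_apply] at this ⊢
    linarith
  have hdis' := dissip_vf G h f g q r hq d ybar L hL xs ms xis ths phs hxs hms hxis hths hphs
  have hfin := gen_conv a hac ham T hT (fun t => vf G h f g q r d ybar L (zz t)) zz hz _
    (fun t _ => by rw [hdis']; linarith [hdisnn (zz t)]) τ hτ0 hlim'
  have hfinj := tendsto_pi_nhds.1 hfin
  exact ⟨xs, ms, xis, ths, phs,
    tendsto_pi_nhds.2 fun i => hfinj (Sum.inl i),
    tendsto_pi_nhds.2 fun i => hfinj (Sum.inr (Sum.inl i)),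
    tendsto_pi_nhds.2 fun i => hfinj (Sum.inr (Sum.inr (Sum.inl i))),
    tendsto_pi_nhds.2 fun i => hfinj (Sum.inr (Sum.inr (Sum.inr (Sum.inl i)))),
    tendsto_pi_nhds.2 fun i => hfinj (Sum.inr (Sum.inr (Sum.inr (Sum.inr i)))),
    hxs, hths, hxis, hms⟩
end

section
/- Assume: G connected with incidence matrix B, E = [I_p;0] with p ≥ 1; each ȳ_i in the range of h_i; L the Laplacian of a balanced strongly connected digraph; h_i, f_k, g_i continuously differentiable strictly increasing with range(f_k) = (λ_k⁻, λ_k⁺), range(g_i) = (u_i⁻, u_i⁺); γ_k, η_i nondecreasing and continuously differentiable; û = Q⁻¹(λ̂·1_p − r) with λ̂ = (1_nᵀd̂ + 1_pᵀQ⁻¹r)/(1_pᵀQ⁻¹1_p), d̂ = d + E_c η(E_cᵀ ȳ), û_i ∈ range(g_i) for all i; and there exists λ̄ with Bλ̄ = Ψ(x̄) + Eû − d componentwise in the ranges of the f_k, where h(x̄) = ȳ. Then every solution on [0,∞) of T_x ẋ = Ψ(x) − B f(μ) + E g(θ) − d (with Ψ(x) = −B_c γ(B_cᵀ h(x)) −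 E_c η(E_cᵀ h(x))), T_μ μ̇ = Bᵀ(h(x) − ȳ) − (f(μ) − ξ), T_ξ ξ̇ = f(μ) − ξ, T_θ θ̇ = −Eᵀ(h(x) − ȳ) − (g(θ) − φ), T_φ φ̇ = g(θ) − φ − Q L (Q φ + r) satisfies the input and flow bounds for all t ≥ 0 and converges as t → ∞ to a point (x*, μ*, ξ*, θ*, φ*) with h(x*) = ȳ and g(θ*) = û. -/
open Matrix BigOperators Filter Topology MeasureTheory

/-- The matrix `E_c ∈ ℝ^{n×p_c}` with exactly one entry `1` per column, indicating at
which node each state-dependent inflow/outflow is located. -/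
def locMatrix (n : ℕ) {pc : ℕ} (loc : Fin pc → Fin n) : Matrix (Fin n) (Fin pc) ℝ :=
  Matrix.of fun i k => if i = loc k then 1 else 0


lemma cc_exists_W (H : ℝ → ℝ) (hc : Continuous H) (hm : StrictMono H) (a : ℝ) :
    ∃ W : ℝ → ℝ, W a = 0 ∧ (∀ x, HasDerivAt W (H x - H a) x) ∧ (∀ x, 0 ≤ W x) ∧
      ∀ ε > 0, ∃ c > 0, ∀ x, ε ≤ |x - a| → c * |x - a| ≤ W x := by
  have hc' : Continuous (fun s => H s - H a) := by fun_prop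
  obtain ⟨W, hWa, hW⟩ : ∃ W : ℝ → ℝ, W a = 0 ∧ ∀ x, HasDerivAt W (H x - H a) x :=
    ⟨fun x => ∫ s in a..x, (H s - H a), by simp, fun x =>
      intervalIntegral.integral_hasDerivAt_right (hc'.intervalIntegrable _ _)
        (hc'.stronglyMeasurableAtFilter _ _) hc'.continuousAt⟩
  have hWc : Continuous W := continuous_iff_continuousAt.2 fun x => (hW x).continuousAt
  have mvt : ∀ x y, x < y → ∃ s, x < s ∧ s < y ∧ W y - W x = (H s - H a) * (y - x) := by
    intro x y hxy
    obtain ⟨s, hs, hs'⟩ := exists_hasDerivAt_eq_slope W (fun x => H x - H a) hxy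
      hWc.continuousOn (fun t _ => hW t)
    refine ⟨s, hs.1, hs.2, ?_⟩
    have : y - x ≠ 0 := by linarith
    rw [hs']; field_simp
  have nonneg : ∀ x, 0 ≤ W x := by
    intro x
    rcases lt_trichotomy x a with hx | hx | hx
    · obtain ⟨s, h1, h2, h3⟩ := mvt x a hx
      have := hm h2
      nlinarith
    · rw [hx, hWa]
    · obtain ⟨s, h1, h2, h3⟩ := mvt a x hx
      have := hm h1
      nlinarith
  refine ⟨W, hWa, hW, nonneg, fun ε hε => ?_⟩
  have e1 : H a < H (a + ε / 2) := hm (by linarith)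
  have e2 : H (a - ε / 2) < H a := hm (by linarith)
  refine ⟨min ((H (a + ε / 2) - H a) / 2) ((H a - H (a - ε / 2)) / 2),
    lt_min (by linarith) (by linarith), fun x hx => ?_⟩
  have m1 := min_le_left ((H (a + ε / 2) - H a) / 2) ((H a - H (a - ε / 2)) / 2)
  have m2 := min_le_right ((H (a + ε / 2) - H a) / 2) ((H a - H (a - ε / 2)) / 2)
  rcases le_total 0 (x - a) with hxa | hxa
  · rw [abs_of_nonneg hxa] at hx ⊢
    obtain ⟨s, h1, h2, h3⟩ := mvt (a + ε / 2) x (by linarith)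
    have := hm h1
    have := nonneg (a + ε / 2)
    have : (H (a + ε / 2) - H a) * (x - (a + ε / 2)) ≤ (H s - H a) * (x - (a + ε / 2)) :=
      mul_le_mul_of_nonneg_right (by linarith) (by linarith)
    have := mul_le_mul_of_nonneg_right m1 hxa
    nlinarith
  · rw [abs_of_nonpos hxa] at hx ⊢
    obtain ⟨s, h1, h2, h3⟩ := mvt x (a - ε / 2) (by linarith)
    have := hm h2
    have := nonneg (a - ε / 2)
    have : (H a - H (a - ε / 2)) * ((a - ε / 2) - x) ≤ (H a - H s) * ((a - ε / 2) - x) :=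
      mul_le_mul_of_nonneg_right (by linarith) (by linarith)
    have := mul_le_mul_of_nonneg_right m2 (by linarith : 0 ≤ -(x - a))
    nlinarith

lemma cc_lyap {ι : Type*} [Fintype ι] (H : ι → ℝ → ℝ) (hc : ∀ j, Continuous (H j))
    (hm : ∀ j, StrictMono (H j)) (T : ι → ℝ) (hT : ∀ j, 0 < T j) (a : ι → ℝ) :
    ∃ V : (ι → ℝ) → ℝ, V a = 0 ∧ Continuous V ∧ (∀ z, 0 ≤ V z) ∧
      (∀ ε > 0, ∀ j, ∃ c > 0, ∀ z : ι → ℝ, ε ≤ |z j - a j| → c * |z j - a j| ≤ V z) ∧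
      ∀ (z : ℝ → ι → ℝ) (t : ℝ) (z' : ι → ℝ), (∀ j, HasDerivAt (fun s => z s j) (z' j / T j) t) →
        HasDerivAt (fun s => V (z s)) (∑ j, (H j (z t j) - H j (a j)) * z' j) t := by
  choose W hWa hW hn hg using fun j => cc_exists_W (H j) (hc j) (hm j) (a j)
  have hWc : ∀ j, Continuous (W j) := fun j =>
    continuous_iff_continuousAt.2 fun x => (hW j x).continuousAt
  refine ⟨fun z => ∑ j, T j * W j (z j), by simp [hWa], by fun_prop,
    fun z => Finset.sum_nonneg fun j _ => mul_nonneg (hT j).le (hn j _), ?_, ?_⟩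
  · intro ε hε j
    obtain ⟨c, hc, hcx⟩ := hg j ε hε
    refine ⟨T j * c, mul_pos (hT j) hc, fun z hz => ?_⟩
    have h1 : T j * W j (z j) ≤ ∑ j, T j * W j (z j) :=
      Finset.single_le_sum (f := fun j => T j * W j (z j))
        (fun j _ => mul_nonneg (hT j).le (hn j _)) (Finset.mem_univ j)
    have h2 := mul_le_mul_of_nonneg_left (hcx _ hz) (hT j).le
    linarith
  · intro z t z' hz
    refine HasDerivAt.fun_sum fun j _ => ?_
    have := ((hW j (z t j)).comp t (hz j)).const_mul (T j)
    have e : T j * ((H j (z t j) - H j (a j)) * (z' j / T j)) =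
        (H j (z t j) - H j (a j)) * z' j := by
      have := (hT j).ne'
      field_simp
    rw [e] at this
    exact this

lemma cc_shift (u v : ℝ → ℝ) (hu : ∀ t, 0 ≤ t → HasDerivAt u (v t) t)
    (hv : Tendsto v atTop (𝓝 0)) (τ : ℝ) (hτ : 0 < τ) :
    Tendsto (fun t => u (t + τ) - u t) atTop (𝓝 0) := by
  rw [Metric.tendsto_atTop] at hv ⊢
  intro ε hε
  obtain ⟨N, hN⟩ := hv (ε / τ) (by positivity)
  refine ⟨max N 0, fun t ht => ?_⟩
  have t0 : 0 ≤ t := le_trans (le_max_right _ _) ht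
  have tN : N ≤ t := le_trans (le_max_left _ _) ht
  obtain ⟨s, hs, hs'⟩ := exists_hasDerivAt_eq_slope u v (by linarith : t < t + τ)
    (fun s hs => (hu s (t0.trans hs.1)).continuousAt.continuousWithinAt)
    (fun s hs => hu s (t0.trans hs.1.le))
  have := hN s (tN.trans hs.1.le)
  rw [Real.dist_eq, sub_zero] at this ⊢
  have e : u (t + τ) - u t = v s * τ := by
    rw [hs', add_sub_cancel_left, div_mul_cancel₀ _ (by positivity)]
  rw [e, abs_mul, abs_of_pos hτ]
  rwa [lt_div_iff₀ hτ] at this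

lemma cc_barbalat (u v : ℝ → ℝ) (hu : ∀ t, 0 ≤ t → HasDerivAt u (v t) t)
    (hv : UniformContinuousOn v (Set.Ici 0))
    (hs : ∀ τ > 0, Tendsto (fun t => u (t + τ) - u t) atTop (𝓝 0)) :
    Tendsto v atTop (𝓝 0) := by
  rw [Metric.uniformContinuousOn_iff] at hv
  rw [Metric.tendsto_atTop]
  intro ε hε
  obtain ⟨δ, hδ, hd⟩ := hv (ε / 2) (by positivity)
  have h2 := hs (δ / 2) (by positivity)
  rw [Metric.tendsto_atTop] at h2
  obtain ⟨N, hN⟩ := h2 (ε / 2 * (δ / 2)) (by positivity)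
  refine ⟨max N 0, fun t ht => ?_⟩
  have t0 : 0 ≤ t := le_trans (le_max_right _ _) ht
  have tN : N ≤ t := le_trans (le_max_left _ _) ht
  obtain ⟨s, hs, hs'⟩ := exists_hasDerivAt_eq_slope u v (by linarith : t < t + δ / 2)
    (fun s hs => (hu s (t0.trans hs.1)).continuousAt.continuousWithinAt)
    (fun s hs => hu s (t0.trans hs.1.le))
  have h3 := hN t tN
  have e : u (t + δ / 2) - u t = v s * (δ / 2) := by
    rw [hs', add_sub_cancel_left, div_mul_cancel₀ _ (by positivity)]
  rw [Real.dist_eq, sub_zero, e, abs_mul, abs_of_pos (by positivity : 0 < δ / 2)] at h3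
  have h3' := lt_of_mul_lt_mul_right h3 (by positivity)
  have h4 := hd t t0 s (t0.trans hs.1.le) (by
    rw [Real.dist_eq, abs_sub_lt_iff]; constructor <;> linarith [hs.1, hs.2])
  rw [Real.dist_eq] at h4 ⊢
  rw [sub_zero]
  have := abs_sub_abs_le_abs_sub (v t) (v s)
  linarith

lemma cc_inv (f : ℝ → ℝ) (hc : Continuous f) (hm : StrictMono f) (a b : ℝ → ℝ) (M : ℝ)
    (ha : ∀ᶠ t in atTop, |a t| ≤ M) (hb : ∀ᶠ t in atTop, |b t| ≤ M)
    (hab : Tendsto (fun t => f (a t) - f (b t)) atTop (𝓝 0)) :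
    Tendsto (fun t => a t - b t) atTop (𝓝 0) := by
  rw [Metric.tendsto_nhds] at hab ⊢
  intro ε hε
  have hK : IsCompact ((Set.Icc (-M) M ×ˢ Set.Icc (-M) M) ∩ {w : ℝ × ℝ | ε ≤ |w.1 - w.2|}) := by
    refine (isCompact_Icc.prod isCompact_Icc).inter_right ?_
    exact isClosed_le continuous_const (by fun_prop)
  rcases Set.eq_empty_or_nonempty
    ((Set.Icc (-M) M ×ˢ Set.Icc (-M) M) ∩ {w : ℝ × ℝ | ε ≤ |w.1 - w.2|}) with he | hne
  · filter_upwards [ha, hb] with t h1 h2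
    rw [Real.dist_eq, sub_zero]
    by_contra hcon
    have : (a t, b t) ∈ ((Set.Icc (-M) M ×ˢ Set.Icc (-M) M) ∩
        {w : ℝ × ℝ | ε ≤ |w.1 - w.2|}) :=
      ⟨⟨abs_le.1 h1, abs_le.1 h2⟩, not_lt.1 hcon⟩
    rw [he] at this
    exact this
  · obtain ⟨w, hw, hmin⟩ := hK.exists_isMinOn hne
      (f := fun w : ℝ × ℝ => |f w.1 - f w.2|) (by fun_prop)
    have hpos : 0 < |f w.1 - f w.2| := by
      rw [abs_pos, sub_ne_zero]
      intro hcon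
      have := hm.injective hcon
      have h2 := hw.2
      simp only [Set.mem_ofPred_eq, this, sub_self, abs_zero] at h2
      linarith
    filter_upwards [ha, hb, hab _ hpos] with t h1 h2 h3
    rw [Real.dist_eq, sub_zero] at h3 ⊢
    by_contra hcon
    have : (a t, b t) ∈ ((Set.Icc (-M) M ×ˢ Set.Icc (-M) M) ∩
        {w : ℝ × ℝ | ε ≤ |w.1 - w.2|}) :=
      ⟨⟨abs_le.1 h1, abs_le.1 h2⟩, not_lt.1 hcon⟩
    have := hmin this
    simp only [Set.mem_ofPred_eq] at this
    linarith

lemma cc_bdd {ι : Type*} [Fintype ι] (H : ι → ℝ → ℝ) (hc : ∀ j, Continuous (H j))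
    (hm : ∀ j, StrictMono (H j)) (T : ι → ℝ) (hT : ∀ j, 0 < T j)
    (F : (ι → ℝ) → ι → ℝ) (z : ℝ → ι → ℝ)
    (hz : ∀ t, 0 ≤ t → ∀ j, HasDerivAt (fun s => z s j) (F (z t) j / T j) t)
    (a : ι → ℝ) (ha : ∀ w, ∑ j, (H j (w j) - H j (a j)) * F w j ≤ 0) :
    ∃ M, ∀ t, 0 ≤ t → ∀ j, |z t j| ≤ M := by
  obtain ⟨V, hVa, hVc, hVn, hVg, hVd⟩ := cc_lyap H hc hm T hT a
  have hanti : AntitoneOn (fun t => V (z t)) (Set.Ici 0) := by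
    refine antitoneOn_of_deriv_nonpos (convex_Ici 0)
      (fun t ht => (hVd z t _ (hz t ht)).continuousAt.continuousWithinAt) ?_ ?_
    · intro t ht
      rw [interior_Ici] at ht
      exact (hVd z t _ (hz t (le_of_lt ht))).differentiableAt.differentiableWithinAt
    · intro t ht
      rw [interior_Ici] at ht
      rw [(hVd z t _ (hz t (le_of_lt ht))).deriv]
      exact ha _
  choose c hc0 hcg using hVg 1 one_pos
  refine ⟨∑ j, (|a j| + 1 + V (z 0) / c j), fun t ht j => ?_⟩
  have hterm : ∀ j, 0 ≤ |a j| + 1 + V (z 0) / c j := fun j => by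
    have := div_nonneg (hVn (z 0)) (hc0 j).le
    positivity
  refine le_trans ?_ (Finset.single_le_sum (fun j _ => hterm j) (Finset.mem_univ j))
  have h0 := div_nonneg (hVn (z 0)) (hc0 j).le
  have hle : V (z t) ≤ V (z 0) := hanti (Set.mem_Ici.2 le_rfl) ht ht
  have h1 : |z t j| ≤ |a j| + |z t j - a j| := by
    have := abs_add_le (a j) (z t j - a j)
    simpa using this
  rcases le_total 1 |z t j - a j| with h2 | h2
  · have h3 := (hcg j (z t) h2).trans hle
    have : |z t j - a j| ≤ V (z 0) / c j := by
      rw [le_div_iff₀ (hc0 j)]; linarith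
    linarith
  · linarith

lemma cc_uc {ι : Type*} [Fintype ι] (T : ι → ℝ)
    (F : (ι → ℝ) → ι → ℝ) (hF : Continuous F) (z : ℝ → ι → ℝ)
    (hz : ∀ t, 0 ≤ t → ∀ j, HasDerivAt (fun s => z s j) (F (z t) j / T j) t)
    (M : ℝ) (hM : ∀ t, 0 ≤ t → ∀ j, |z t j| ≤ M) (Φ : (ι → ℝ) → ℝ) (hΦ : Continuous Φ) :
    UniformContinuousOn (fun t => Φ (z t)) (Set.Ici 0) := by
  have hK : IsCompact (Set.Icc (fun _ : ι => -M) (fun _ : ι => M)) := isCompact_Icc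
  have hmem : ∀ t, 0 ≤ t → z t ∈ Set.Icc (fun _ : ι => -M) (fun _ : ι => M) := fun t ht =>
    ⟨fun j => (abs_le.1 (hM t ht j)).1, fun j => (abs_le.1 (hM t ht j)).2⟩
  have hG : Continuous (fun w => (fun j => F w j / T j)) := by
    have := continuous_pi_iff.1 hF
    exact continuous_pi fun j => (this j).div_const _
  obtain ⟨C, hC⟩ := hK.exists_bound_of_continuousOn hG.continuousOn
  have hlip : LipschitzOnWith (Real.toNNReal C) z (Set.Ici 0) := by
    refine (convex_Ici 0).lipschitzOnWith_of_nnnorm_hasDerivWithin_le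
      (f' := fun t => (fun j => F (z t) j / T j)) ?_ ?_
    · intro t ht
      exact (hasDerivAt_pi.2 (hz t ht)).hasDerivWithinAt
    · intro t ht
      rw [← NNReal.coe_le_coe, coe_nnnorm]
      exact (hC _ (hmem t ht)).trans (Real.le_coe_toNNReal C)
  have h1 := hlip.uniformContinuousOn
  have h2 := hK.uniformContinuousOn_of_continuous hΦ.continuousOn
  exact h2.comp h1 (fun t ht => hmem t ht)

lemma cc_diss {ι : Type*} [Fintype ι] (H : ι → ℝ → ℝ) (hc : ∀ j, Continuous (H j))
    (hm : ∀ j, StrictMono (H j)) (T : ι → ℝ) (hT : ∀ j, 0 < T j)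
    (F : (ι → ℝ) → ι → ℝ) (hF : Continuous F) (z : ℝ → ι → ℝ)
    (hz : ∀ t, 0 ≤ t → ∀ j, HasDerivAt (fun s => z s j) (F (z t) j / T j) t)
    (a : ι → ℝ) (ha : ∀ w, ∑ j, (H j (w j) - H j (a j)) * F w j ≤ 0) :
    Tendsto (fun t => ∑ j, (H j (z t j) - H j (a j)) * F (z t) j) atTop (𝓝 0) := by
  obtain ⟨M, hM⟩ := cc_bdd H hc hm T hT F z hz a ha
  obtain ⟨V, hVa, hVc, hVn, hVg, hVd⟩ := cc_lyap H hc hm T hT a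
  have hanti : AntitoneOn (fun t => V (z t)) (Set.Ici 0) := by
    refine antitoneOn_of_deriv_nonpos (convex_Ici 0)
      (fun t ht => (hVd z t _ (hz t ht)).continuousAt.continuousWithinAt) ?_ ?_
    · intro t ht
      rw [interior_Ici] at ht
      exact (hVd z t _ (hz t (le_of_lt ht))).differentiableAt.differentiableWithinAt
    · intro t ht
      rw [interior_Ici] at ht
      rw [(hVd z t _ (hz t (le_of_lt ht))).deriv]
      exact ha _
  have hF' := continuous_pi_iff.1 hF
  refine cc_barbalat (fun t => V (z t)) _ (fun t ht => hVd z t _ (hz t ht))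
    (cc_uc T F hF z hz M hM (fun w => ∑ j, (H j (w j) - H j (a j)) * F w j) (by fun_prop)) ?_
  intro τ hτ
  have hA : Antitone (fun t => V (z (max t 0))) := fun s t hst =>
    hanti (Set.mem_Ici.2 (le_max_right _ _)) (Set.mem_Ici.2 (le_max_right _ _)) (max_le_max_right 0 hst)
  have hlim := tendsto_atTop_ciInf hA ⟨0, by rintro _ ⟨t, rfl⟩; exact hVn _⟩
  have hlim' : Tendsto (fun t => V (z t)) atTop (𝓝 (⨅ i, V (z (max i 0)))) := by
    refine hlim.congr' ?_
    filter_upwards [eventually_ge_atTop 0] with t ht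
    rw [max_eq_left ht]
  have := (hlim'.comp (tendsto_atTop_add_const_right atTop τ tendsto_id)).sub hlim'
  simpa using this

lemma cc_conv {ι : Type*} [Fintype ι] (H : ι → ℝ → ℝ) (hc : ∀ j, Continuous (H j))
    (hm : ∀ j, StrictMono (H j)) (T : ι → ℝ) (hT : ∀ j, 0 < T j)
    (F : (ι → ℝ) → ι → ℝ) (z : ℝ → ι → ℝ)
    (hz : ∀ t, 0 ≤ t → ∀ j, HasDerivAt (fun s => z s j) (F (z t) j / T j) t)
    (a : ι → ℝ) (ha : ∀ w, ∑ j, (H j (w j) - H j (a j)) * F w j ≤ 0)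
    (hcl : MapClusterPt a atTop z) : Tendsto z atTop (𝓝 a) := by
  obtain ⟨V, hVa, hVc, hVn, hVg, hVd⟩ := cc_lyap H hc hm T hT a
  have hanti : AntitoneOn (fun t => V (z t)) (Set.Ici 0) := by
    refine antitoneOn_of_deriv_nonpos (convex_Ici 0)
      (fun t ht => (hVd z t _ (hz t ht)).continuousAt.continuousWithinAt) ?_ ?_
    · intro t ht
      rw [interior_Ici] at ht
      exact (hVd z t _ (hz t (le_of_lt ht))).differentiableAt.differentiableWithinAt
    · intro t ht
      rw [interior_Ici] at ht
      rw [(hVd z t _ (hz t (le_of_lt ht))).deriv]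
      exact ha _
  rw [tendsto_pi_nhds]
  intro j
  rw [Metric.tendsto_nhds]
  intro ε hε
  obtain ⟨c, hc0, hcg⟩ := hVg ε hε j
  have hopen : {w | V w < c * ε} ∈ 𝓝 a := by
    refine (isOpen_lt hVc continuous_const).mem_nhds ?_
    simp only [Set.mem_ofPred_eq, hVa]
    positivity
  have hfr := (mapClusterPt_iff_frequently.1 hcl _ hopen).and_eventually
    (eventually_ge_atTop (0 : ℝ))
  obtain ⟨t0, ht0, h0⟩ := hfr.exists
  filter_upwards [eventually_ge_atTop t0] with t ht
  rw [Real.dist_eq]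
  by_contra hcon
  push Not at hcon
  have h1 := hcg (z t) hcon
  have h2 : V (z t) ≤ V (z t0) := hanti h0 (le_trans h0 ht) ht
  have h3 : V (z t0) < c * ε := ht0
  have := mul_le_mul_of_nonneg_left hcon hc0.le
  linarith

lemma cc_cluster {ι : Type*} [Fintype ι] (z : ℝ → ι → ℝ)
    (M : ℝ) (hM : ∀ t, 0 ≤ t → ∀ j, |z t j| ≤ M) : ∃ b, MapClusterPt b atTop z := by
  have hK : IsCompact (Set.Icc (fun _ : ι => -M) (fun _ : ι => M)) := isCompact_Icc
  obtain ⟨b, -, hb⟩ := hK.exists_mapClusterPt (f := atTop) (u := z) (tendsto_principal.2 (by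
    filter_upwards [eventually_ge_atTop 0] with t ht
    exact ⟨fun j => (abs_le.1 (hM t ht j)).1, fun j => (abs_le.1 (hM t ht j)).2⟩))
  exact ⟨b, hb⟩

lemma cc_cluster_eq {ι : Type*} (z : ℝ → ι → ℝ) (b : ι → ℝ)
    (hb : MapClusterPt b atTop z) (Φ : (ι → ℝ) → ℝ) (hΦ : Continuous Φ) (c : ℝ)
    (h : Tendsto (fun t => Φ (z t)) atTop (𝓝 c)) : Φ b = c := by
  have h1 : MapClusterPt (Φ b) atTop (Φ ∘ z) := hb.continuousAt_comp hΦ.continuousAt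
  have h2 : ClusterPt (Φ b) (𝓝 c) := h1.clusterPt.mono h
  exact eq_of_nhds_neBot h2

lemma cc_sq_le (a D : ℝ → ℝ) (c : ℝ) (hc : 0 < c) (h : ∀ t, c * (a t) ^ 2 ≤ D t)
    (hD : Tendsto D atTop (𝓝 0)) : Tendsto a atTop (𝓝 0) := by
  have h1 : Tendsto (fun t => (a t) ^ 2) atTop (𝓝 0) := by
    have hD' : Tendsto (fun t => D t / c) atTop (𝓝 0) := by simpa using hD.div_const c
    refine squeeze_zero (fun t => sq_nonneg _) (fun t => ?_) hD'
    rw [le_div_iff₀ hc]; linarith [h t]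
  have h2 := (Real.continuous_sqrt.tendsto 0).comp h1
  rw [Real.sqrt_zero] at h2
  refine (tendsto_zero_iff_abs_tendsto_zero _).2 (h2.congr fun t => ?_)
  simp [Real.sqrt_sq_eq_abs]

lemma cc_rtg {ι : Type*} (R : ι → ι → Prop) (w : ℝ → ι → ℝ)
    (h : ∀ a b, R a b → Tendsto (fun t => w t a - w t b) atTop (𝓝 0)) (i j : ι)
    (hij : Relation.ReflTransGen R i j) : Tendsto (fun t => w t i - w t j) atTop (𝓝 0) := by
  induction hij with
  | refl => simp
  | tail _ hbc ih =>
    have := ih.add (h _ _ hbc)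
    simpa using this

lemma cc_lap {p : ℕ} (L : Matrix (Fin p) (Fin p) ℝ) (hL : IsBalancedStronglyConnectedLaplacian L)
    (w : Fin p → ℝ) :
    w ⬝ᵥ (L *ᵥ w) = (∑ i, ∑ j, (-L i j) * (w i - w j) ^ 2) / 2 := by
  have hr : ∀ i, ∑ j, L i j = 0 := fun i => by
    have := congrFun hL.rowsum i
    simpa [mulVec, dotProduct] using this
  have hcs : ∀ j, ∑ i, L i j = 0 := fun i => by
    have := congrFun hL.colsum i
    simpa [vecMul, dotProduct] using this
  have h1 : ∑ i, ∑ j, (-L i j) * (w i - w j) ^ 2 =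
      (∑ i, ∑ j, (-(w i ^ 2)) * L i j) + (∑ i, ∑ j, (-(w j ^ 2)) * L i j)
        + 2 * ∑ i, ∑ j, w i * (L i j * w j) := by
    rw [Finset.mul_sum, ← Finset.sum_add_distrib, ← Finset.sum_add_distrib]
    refine Finset.sum_congr rfl fun i _ => ?_
    rw [Finset.mul_sum, ← Finset.sum_add_distrib, ← Finset.sum_add_distrib]
    refine Finset.sum_congr rfl fun j _ => ?_
    ring
  have h2 : ∑ i, ∑ j, (-(w i ^ 2)) * L i j = 0 := by
    simp [← Finset.mul_sum, hr]
  have h3 : ∑ i, ∑ j, (-(w j ^ 2)) * L i j = 0 := by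
    rw [Finset.sum_comm]
    simp [← Finset.mul_sum, hcs]
  have h4 : w ⬝ᵥ (L *ᵥ w) = ∑ i, ∑ j, w i * (L i j * w j) := by
    simp [dotProduct, mulVec, Finset.mul_sum]
  rw [h1, h2, h3, h4]
  ring

lemma cc_diss_alg {n m p : ℕ} (B : Matrix (Fin n) (Fin m) ℝ) (E : Matrix (Fin n) (Fin p) ℝ)
    (L : Matrix (Fin p) (Fin p) ℝ) (hL : IsBalancedStronglyConnectedLaplacian L)
    (q r : Fin p → ℝ) (d y yb Py Pyb : Fin n → ℝ) (u ub ξ : Fin m → ℝ) (v vb φ : Fin p → ℝ) (c : ℝ)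
    (hP : (y - yb) ⬝ᵥ (Py - Pyb) ≤ 0) (heq : Pyb - B *ᵥ ub + E *ᵥ vb - d = 0)
    (hc : ∀ i, q i * vb i + r i = c) :
    (y - yb) ⬝ᵥ (Py - B *ᵥ u + E *ᵥ v - d) +
      ((u - ub) ⬝ᵥ (Bᵀ *ᵥ (y - yb) - (u - ξ)) +
      ((ξ - ub) ⬝ᵥ (u - ξ) +
      ((v - vb) ⬝ᵥ (-(Eᵀ *ᵥ (y - yb)) - (v - φ)) +
      (φ - vb) ⬝ᵥ (v - φ - diagonal q *ᵥ (L *ᵥ (diagonal q *ᵥ φ + r)))))) ≤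
    -((∑ k, (u k - ξ k) ^ 2) + (∑ i, (v i - φ i) ^ 2) +
      (∑ i, ∑ j, (-L i j) * ((q i * φ i + r i) - (q j * φ j + r j)) ^ 2) / 2) := by
  have e1 : Py - B *ᵥ u + E *ᵥ v - d = (Py - Pyb) - B *ᵥ (u - ub) + E *ᵥ (v - vb) := by
    have : d = Pyb - B *ᵥ ub + E *ᵥ vb := (sub_eq_zero.1 heq).symm
    rw [this, mulVec_sub, mulVec_sub]
    abel
  set w : Fin p → ℝ := diagonal q *ᵥ φ + r with hw
  have hwi : ∀ i, w i = q i * φ i + r i := fun i => by simp [hw, mulVec_diagonal]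
  have e2 : (φ - vb) ⬝ᵥ (diagonal q *ᵥ (L *ᵥ w)) = w ⬝ᵥ (L *ᵥ w) := by
    have h1 : (φ - vb) ⬝ᵥ (diagonal q *ᵥ (L *ᵥ w)) = (w - c • (fun _ => 1)) ⬝ᵥ (L *ᵥ w) := by
      simp only [dotProduct]
      refine Finset.sum_congr rfl fun i _ => ?_
      simp only [mulVec_diagonal, Pi.sub_apply, Pi.smul_apply, hwi, smul_eq_mul, ← hc i]
      ring
    rw [h1, sub_dotProduct, smul_dotProduct, dotProduct_mulVec (fun _ => (1 : ℝ)), hL.colsum]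
    simp
  have e3 : (y - yb) ⬝ᵥ (B *ᵥ (u - ub)) = (u - ub) ⬝ᵥ (Bᵀ *ᵥ (y - yb)) := by
    rw [dotProduct_mulVec, mulVec_transpose, dotProduct_comm]
  have e4 : (y - yb) ⬝ᵥ (E *ᵥ (v - vb)) = (v - vb) ⬝ᵥ (Eᵀ *ᵥ (y - yb)) := by
    rw [dotProduct_mulVec, mulVec_transpose, dotProduct_comm]
  have e5 : (∑ k, (u k - ξ k) ^ 2) = (u - ub) ⬝ᵥ (u - ξ) - (ξ - ub) ⬝ᵥ (u - ξ) := by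
    rw [← sub_dotProduct, sub_sub_sub_cancel_right]
    simp [dotProduct, sq]
  have e6 : (∑ k, (v k - φ k) ^ 2) = (v - vb) ⬝ᵥ (v - φ) - (φ - vb) ⬝ᵥ (v - φ) := by
    rw [← sub_dotProduct, sub_sub_sub_cancel_right]
    simp [dotProduct, sq]
  have e7 := cc_lap L hL w
  simp only [hwi] at e7
  rw [← e7, e5, e6, e1]
  rw [dotProduct_add, dotProduct_sub (y - yb), dotProduct_sub (u - ub),
    dotProduct_sub (v - vb), dotProduct_sub (φ - vb), e2, e3, e4, dotProduct_neg]
  linarith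

lemma cc_sum5 {a b c d e : Type*} [Fintype a] [Fintype b] [Fintype c] [Fintype d] [Fintype e]
    (u : a ⊕ b ⊕ c ⊕ d ⊕ e → ℝ) :
    ∑ j, u j = ∑ i, u (.inl i) + (∑ i, u (.inr (.inl i)) + (∑ i, u (.inr (.inr (.inl i))) +
      (∑ i, u (.inr (.inr (.inr (.inl i)))) + ∑ i, u (.inr (.inr (.inr (.inr i))))))) := by
  simp only [Fintype.sum_sum_type]

lemma cc_incT {n m : ℕ} (G : OrientedGraph n m) (y : Fin n → ℝ) (k : Fin m) :
    ((G.inc)ᵀ *ᵥ y) k = y (G.pos k) - y (G.neg k) := by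
  have h1 : ∀ i, (G.inc)ᵀ k i * y i =
      (if i = G.pos k then y i else 0) - (if i = G.neg k then y i else 0) := by
    intro i
    have := G.ne_ends k
    simp only [OrientedGraph.inc, transpose_apply, of_apply]
    by_cases h1 : i = G.pos k
    · have h2 : i ≠ G.neg k := fun h => this (h1 ▸ h)
      rw [if_pos h1, if_pos h1, if_neg h2]; ring
    · by_cases h2 : i = G.neg k
      · rw [if_neg h1, if_neg h1, if_pos h2, if_pos h2]; ring
      · rw [if_neg h1, if_neg h1, if_neg h2, if_neg h2]; ring
  simp only [mulVec, dotProduct, h1, Finset.sum_sub_distrib]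
  simp

lemma cc_selT {n p : ℕ} (hpn : p ≤ n) (y : Fin n → ℝ) (k : Fin p) :
    ((selE n p)ᵀ *ᵥ y) k = y (Fin.castLE hpn k) := by
  have h1 : ∀ i : Fin n, (selE n p)ᵀ k i * y i = if i = Fin.castLE hpn k then y i else 0 := by
    intro i
    simp [selE, Fin.ext_iff]
  simp only [mulVec, dotProduct, h1]
  simp

lemma cc_sum_mulVec {n m : ℕ} (M : Matrix (Fin n) (Fin m) ℝ) (u : Fin m → ℝ) :
    ∑ i, (M *ᵥ u) i = ∑ k, (Mᵀ *ᵥ (fun _ => 1)) k * u k := by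
  have : (fun _ => (1 : ℝ)) ⬝ᵥ (M *ᵥ u) = (Mᵀ *ᵥ (fun _ => 1)) ⬝ᵥ u := by
    rw [dotProduct_mulVec, mulVec_transpose]
  simpa [dotProduct] using this

lemma cc_mono {n l : ℕ} (M : Matrix (Fin n) (Fin l) ℝ) (γ : Fin l → ℝ → ℝ)
    (hγ : ∀ k, Monotone (γ k)) (y yb : Fin n → ℝ) :
    0 ≤ (y - yb) ⬝ᵥ (M *ᵥ cw γ (Mᵀ *ᵥ y) - M *ᵥ cw γ (Mᵀ *ᵥ yb)) := by
  rw [← mulVec_sub, dotProduct_mulVec, ← mulVec_transpose, mulVec_sub]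
  refine Finset.sum_nonneg fun k _ => ?_
  simp only [Pi.sub_apply, cw]
  rcases le_total ((Mᵀ *ᵥ y) k) ((Mᵀ *ᵥ yb) k) with h | h
  · exact mul_nonneg_of_nonpos_of_nonpos (by linarith) (by linarith [hγ k h])
  · exact mul_nonneg (by linarith) (by linarith [hγ k h])

theorem cc_core {n m p : ℕ} (hp : 0 < p) (hpn : p ≤ n)
    (G : OrientedGraph n m) (hG : G.Connected)
    (h : Fin n → ℝ → ℝ) (hh : ∀ i, Continuous (h i) ∧ StrictMono (h i))
    (f : Fin m → ℝ → ℝ) (hf : ∀ k, Continuous (f k) ∧ StrictMono (f k))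
    (g : Fin p → ℝ → ℝ) (hg : ∀ i, Continuous (g i) ∧ StrictMono (g i))
    (P : (Fin n → ℝ) → Fin n → ℝ) (hPc : Continuous P)
    (q r : Fin p → ℝ) (d ybar : Fin n → ℝ)
    (hP : ∀ y, (y - ybar) ⬝ᵥ (P y - P ybar) ≤ 0)
    (L : Matrix (Fin p) (Fin p) ℝ) (hL : IsBalancedStronglyConnectedLaplacian L)
    (Tx : Fin n → ℝ) (Tm Txi : Fin m → ℝ) (Tth Tph : Fin p → ℝ)
    (hTx : ∀ i, 0 < Tx i) (hTm : ∀ k, 0 < Tm k) (hTxi : ∀ k, 0 < Txi k)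
    (hTth : ∀ i, 0 < Tth i) (hTph : ∀ i, 0 < Tph i)
    (xb : Fin n → ℝ) (hxb : cw h xb = ybar) (mb : Fin m → ℝ) (tb : Fin p → ℝ)
    (heq : P ybar - G.inc *ᵥ (cw f mb) + selE n p *ᵥ (cw g tb) - d = 0)
    (hcb : ∃ c, ∀ i, q i * cw g tb i + r i = c)
    (x : ℝ → Fin n → ℝ) (μ ξ : ℝ → Fin m → ℝ) (θ φ : ℝ → Fin p → ℝ)
    (hxode : ∀ t, 0 ≤ t → ∀ i, HasDerivAt (fun s => x s i)
      (((P (cw h (x t)) - G.inc *ᵥ (cw f (μ t)) + selE n p *ᵥ (cw g (θ t)) - d) i) / Tx i) t)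
    (hμode : ∀ t, 0 ≤ t → ∀ k, HasDerivAt (fun s => μ s k)
      ((((G.inc)ᵀ *ᵥ (cw h (x t) - ybar) - (cw f (μ t) - ξ t)) k) / Tm k) t)
    (hξode : ∀ t, 0 ≤ t → ∀ k, HasDerivAt (fun s => ξ s k)
      (((cw f (μ t) - ξ t) k) / Txi k) t)
    (hθode : ∀ t, 0 ≤ t → ∀ i, HasDerivAt (fun s => θ s i)
      (((-((selE n p)ᵀ *ᵥ (cw h (x t) - ybar)) - (cw g (θ t) - φ t)) i) / Tth i) t)
    (hφode : ∀ t, 0 ≤ t → ∀ i, HasDerivAt (fun s => φ s i)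
      (((cw g (θ t) - φ t -
        diagonal q *ᵥ (L *ᵥ (diagonal q *ᵥ (φ t) + r))) i) / Tph i) t) :
    ∃ (xs : Fin n → ℝ) (ms xis : Fin m → ℝ) (ths phs : Fin p → ℝ),
      Tendsto x atTop (𝓝 xs) ∧ Tendsto μ atTop (𝓝 ms) ∧ Tendsto ξ atTop (𝓝 xis) ∧
      Tendsto θ atTop (𝓝 ths) ∧ Tendsto φ atTop (𝓝 phs) ∧
      cw h xs = ybar ∧ P ybar - G.inc *ᵥ (cw f ms) + selE n p *ᵥ (cw g ths) - d = 0 ∧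
      ∃ c, ∀ i, q i * cw g ths i + r i = c := by
  classical
  have hhc := fun i => (hh i).1
  have hfc := fun i => (hf i).1
  have hgc := fun i => (hg i).1
  let ι := Fin n ⊕ Fin m ⊕ Fin m ⊕ Fin p ⊕ Fin p
  let st : (Fin n → ℝ) → (Fin m → ℝ) → (Fin m → ℝ) → (Fin p → ℝ) → (Fin p → ℝ) → ι → ℝ :=
    fun a b c d e => Sum.elim a (Sum.elim b (Sum.elim c (Sum.elim d e)))
  let H : ι → ℝ → ℝ := Sum.elim h (Sum.elim f (Sum.elim (fun _ => id) (Sum.elim g (fun _ => id))))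
  let T : ι → ℝ := st Tx Tm Txi Tth Tph
  let p1 : (ι → ℝ) → Fin n → ℝ := fun w i => w (.inl i)
  let p2 : (ι → ℝ) → Fin m → ℝ := fun w i => w (.inr (.inl i))
  let p3 : (ι → ℝ) → Fin m → ℝ := fun w i => w (.inr (.inr (.inl i)))
  let p4 : (ι → ℝ) → Fin p → ℝ := fun w i => w (.inr (.inr (.inr (.inl i))))
  let p5 : (ι → ℝ) → Fin p → ℝ := fun w i => w (.inr (.inr (.inr (.inr i))))
  let F1 : (ι → ℝ) → Fin n → ℝ := fun w =>
    P (cw h (p1 w)) - G.inc *ᵥ (cw f (p2 w)) + selE n p *ᵥ (cw g (p4 w)) - d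
  let F2 : (ι → ℝ) → Fin m → ℝ := fun w =>
    (G.inc)ᵀ *ᵥ (cw h (p1 w) - ybar) - (cw f (p2 w) - p3 w)
  let F3 : (ι → ℝ) → Fin m → ℝ := fun w => cw f (p2 w) - p3 w
  let F4 : (ι → ℝ) → Fin p → ℝ := fun w =>
    -((selE n p)ᵀ *ᵥ (cw h (p1 w) - ybar)) - (cw g (p4 w) - p5 w)
  let F5 : (ι → ℝ) → Fin p → ℝ := fun w => cw g (p4 w) - p5 w -
        diagonal q *ᵥ (L *ᵥ (diagonal q *ᵥ (p5 w) + r))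
  let F : (ι → ℝ) → ι → ℝ := fun w => st (F1 w) (F2 w) (F3 w) (F4 w) (F5 w)
  let z : ℝ → ι → ℝ := fun t => st (x t) (μ t) (ξ t) (θ t) (φ t)
  have c1 : Continuous p1 := continuous_pi fun i => continuous_apply _
  have c2 : Continuous p2 := continuous_pi fun i => continuous_apply _
  have c3 : Continuous p3 := continuous_pi fun i => continuous_apply _
  have c4 : Continuous p4 := continuous_pi fun i => continuous_apply _
  have c5 : Continuous p5 := continuous_pi fun i => continuous_apply _
  have ch : Continuous (fun w => cw h (p1 w)) :=
    continuous_pi fun i => (hhc i).comp (continuous_apply _)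
  have cf : Continuous (fun w => cw f (p2 w)) :=
    continuous_pi fun i => (hfc i).comp (continuous_apply _)
  have cg : Continuous (fun w => cw g (p4 w)) :=
    continuous_pi fun i => (hgc i).comp (continuous_apply _)
  have cF1 : Continuous F1 :=
    (((hPc.comp ch).sub (continuous_const.matrix_mulVec cf)).add
      (continuous_const.matrix_mulVec cg)).sub continuous_const
  have cF2 : Continuous F2 :=
    (continuous_const.matrix_mulVec (ch.sub continuous_const)).sub (cf.sub c3)
  have cF3 : Continuous F3 := cf.sub c3
  have cF4 : Continuous F4 :=
    (continuous_const.matrix_mulVec (ch.sub continuous_const)).neg.sub (cg.sub c5)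
  have cF5 : Continuous F5 :=
    (cg.sub c5).sub (continuous_const.matrix_mulVec (continuous_const.matrix_mulVec
      ((continuous_const.matrix_mulVec c5).add continuous_const)))
  have hF : Continuous F := by
    refine continuous_pi fun j => ?_
    rcases j with j | j | j | j | j
    · exact (continuous_apply j).comp cF1
    · exact (continuous_apply j).comp cF2
    · exact (continuous_apply j).comp cF3
    · exact (continuous_apply j).comp cF4
    · exact (continuous_apply j).comp cF5
  have hHc : ∀ j, Continuous (H j) := by
    rintro (j | j | j | j | j)
    · exact hhc j
    · exact hfc j
    · exact continuous_id
    · exact hgc j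
    · exact continuous_id
  have hHm : ∀ j, StrictMono (H j) := by
    rintro (j | j | j | j | j)
    · exact (hh j).2
    · exact (hf j).2
    · exact strictMono_id
    · exact (hg j).2
    · exact strictMono_id
  have hT : ∀ j, 0 < T j := by
    rintro (j | j | j | j | j)
    · exact hTx j
    · exact hTm j
    · exact hTxi j
    · exact hTth j
    · exact hTph j
  have hz : ∀ t, 0 ≤ t → ∀ j, HasDerivAt (fun s => z s j) (F (z t) j / T j) t := by
    rintro t ht (j | j | j | j | j)
    · exact hxode t ht j
    · exact hμode t ht j
    · exact hξode t ht j
    · exact hθode t ht j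
    · exact hφode t ht j
  let D : (ι → ℝ) → ℝ := fun w =>
    (∑ k, (cw f (p2 w) k - p3 w k) ^ 2) + (∑ i, (cw g (p4 w) i - p5 w i) ^ 2) +
      (∑ i, ∑ j, (-L i j) * ((q i * p5 w i + r i) - (q j * p5 w j + r j)) ^ 2) / 2
  have key : ∀ xa ma ta, cw h xa = ybar →
      P ybar - G.inc *ᵥ (cw f ma) + selE n p *ᵥ (cw g ta) - d = 0 →
      (∃ c, ∀ i, q i * cw g ta i + r i = c) →
      ∀ w, ∑ j, (H j (w j) - H j (st xa ma (cw f ma) ta (cw g ta) j)) * F w j ≤ - D w := by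
    rintro xa ma ta hxa hea ⟨c, hca⟩ w
    have := cc_diss_alg G.inc (selE n p) L hL q r d (cw h (p1 w)) ybar (P (cw h (p1 w))) (P ybar)
      (cw f (p2 w)) (cw f ma) (p3 w) (cw g (p4 w)) (cw g ta) (p5 w) c (hP _) hea hca
    refine le_trans (le_of_eq ?_) this
    have hy' : ∀ i, h i (xa i) = ybar i := congrFun hxa
    refine (cc_sum5 _).trans ?_
    refine congrArg₂ (· + ·) (Finset.sum_congr rfl fun i _ => ?_) rfl
    change (h i (w (.inl i)) - h i (xa i)) * F1 w i = (h i (w (.inl i)) - ybar i) * F1 w i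
    rw [hy' i]
  have hLt : ∀ w : Fin p → ℝ, ∀ i j, 0 ≤ (-L i j) * (w i - w j) ^ 2 := by
    intro w i j
    by_cases hij : i = j
    · simp [hij]
    · exact mul_nonneg (by linarith [hL.offdiag_nonpos i j hij]) (sq_nonneg _)
  have D3n : ∀ w : Fin p → ℝ, 0 ≤ ∑ i, ∑ j, (-L i j) * (w i - w j) ^ 2 := fun w =>
    Finset.sum_nonneg fun i _ => Finset.sum_nonneg fun j _ => hLt w i j
  have D1n : ∀ w, 0 ≤ ∑ k, (cw f (p2 w) k - p3 w k) ^ 2 := fun w =>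
    Finset.sum_nonneg fun i _ => sq_nonneg _
  have D2n : ∀ w, 0 ≤ ∑ k, (cw g (p4 w) k - p5 w k) ^ 2 := fun w =>
    Finset.sum_nonneg fun i _ => sq_nonneg _
  have hDn : ∀ w, 0 ≤ D w := fun w => by
    have := D1n w
    have := D2n w
    have := D3n (fun i => q i * p5 w i + r i)
    simp only [D]
    positivity
  have key0 := fun w => key xb mb tb hxb heq hcb w
  have key0' := fun w => (key0 w).trans (neg_nonpos.2 (hDn w))
  obtain ⟨M, hM⟩ := cc_bdd H hHc hHm T hT F z hz _ key0'
  have hDt : Tendsto (fun t => D (z t)) atTop (𝓝 0) := by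
    have h1 := (cc_diss H hHc hHm T hT F hF z hz _ key0').neg
    rw [neg_zero] at h1
    exact squeeze_zero (fun t => hDn _) (fun t => by linarith [key0 (z t)]) h1
  have huc := fun Φ hΦ => cc_uc T F hF z hz M hM Φ hΦ
  have l1 : ∀ k, Tendsto (fun t => f k (μ t k) - ξ t k) atTop (𝓝 0) := by
    intro k
    refine cc_sq_le _ _ 1 one_pos (fun t => ?_) hDt
    have a1 : (f k (μ t k) - ξ t k) ^ 2 ≤ ∑ k, (cw f (p2 (z t)) k - p3 (z t) k) ^ 2 :=
      Finset.single_le_sum (f := fun k => (cw f (p2 (z t)) k - p3 (z t) k) ^ 2)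
        (fun i _ => sq_nonneg _) (Finset.mem_univ k)
    have a2 := D2n (z t)
    have a3 := D3n (fun i => q i * p5 (z t) i + r i)
    simp only [D]
    linarith
  have l2 : ∀ k, Tendsto (fun t => g k (θ t k) - φ t k) atTop (𝓝 0) := by
    intro k
    refine cc_sq_le _ _ 1 one_pos (fun t => ?_) hDt
    have a1 : (g k (θ t k) - φ t k) ^ 2 ≤ ∑ k, (cw g (p4 (z t)) k - p5 (z t) k) ^ 2 :=
      Finset.single_le_sum (f := fun k => (cw g (p4 (z t)) k - p5 (z t) k) ^ 2)
        (fun i _ => sq_nonneg _) (Finset.mem_univ k)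
    have a2 := D1n (z t)
    have a3 := D3n (fun i => q i * p5 (z t) i + r i)
    simp only [D]
    linarith
  have l3 : ∀ i j, Tendsto (fun t => (q i * φ t i + r i) - (q j * φ t j + r j)) atTop (𝓝 0) := by
    intro i j
    refine cc_rtg _ (fun t i => q i * φ t i + r i) ?_ i j (hL.sconn i j)
    rintro a b ⟨-, hab⟩
    refine cc_sq_le _ _ (-L a b / 2) (by linarith) (fun t => ?_) hDt
    have a0 : (-L a b) * ((q a * φ t a + r a) - (q b * φ t b + r b)) ^ 2 ≤
        ∑ i, ∑ j, (-L i j) * ((q i * p5 (z t) i + r i) - (q j * p5 (z t) j + r j)) ^ 2 := by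
      refine le_trans ?_ (Finset.single_le_sum
        (f := fun i => ∑ j, (-L i j) * ((q i * p5 (z t) i + r i) - (q j * p5 (z t) j + r j)) ^ 2)
        (fun i _ => Finset.sum_nonneg fun j _ => hLt (fun i => q i * p5 (z t) i + r i) i j)
        (Finset.mem_univ a))
      exact (Finset.single_le_sum
        (f := fun j => (-L a j) * ((q a * p5 (z t) a + r a) - (q j * p5 (z t) j + r j)) ^ 2)
        (fun j _ => hLt (fun i => q i * p5 (z t) i + r i) a j)
        (Finset.mem_univ b))
    have a1 := D1n (z t)
    have a2 := D2n (z t)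
    simp only [D]
    linarith
  have s3 : ∀ k, ∀ τ > 0, Tendsto (fun t => ξ (t + τ) k - ξ t k) atTop (𝓝 0) := by
    intro k τ hτ
    refine cc_shift (fun t => ξ t k) _ (fun t ht => hξode t ht k) ?_ τ hτ
    simpa [cw] using (l1 k).div_const (Txi k)
  have hrow : ∀ i, ∑ j, L i j = 0 := fun i => by
    have := congrFun hL.rowsum i
    simpa [mulVec, dotProduct] using this
  have lLv : ∀ i, Tendsto (fun t => (L *ᵥ (diagonal q *ᵥ (φ t) + r)) i) atTop (𝓝 0) := by
    intro i
    have e : ∀ t, (L *ᵥ (diagonal q *ᵥ (φ t) + r)) i =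
        ∑ j, L i j * ((q j * φ t j + r j) - (q i * φ t i + r i)) := by
      intro t
      simp only [mul_sub, Finset.sum_sub_distrib, ← Finset.sum_mul, hrow]
      simp [mulVec, dotProduct, diagonal_apply]
    simp only [e]
    have := tendsto_finsetSum Finset.univ (fun j _ => (l3 j i).const_mul (L i j))
    simpa using this
  have s5 : ∀ k, ∀ τ > 0, Tendsto (fun t => φ (t + τ) k - φ t k) atTop (𝓝 0) := by
    intro k τ hτ
    refine cc_shift (fun t => φ t k) _ (fun t ht => hφode t ht k) ?_ τ hτ
    have := ((l2 k).sub ((lLv k).const_mul (q k))).div_const (Tph k)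
    simpa [cw, mulVec_diagonal, -mulVec_mulVec] using this
  have bnd : ∀ j, ∀ᶠ t in atTop, |z t j| ≤ M := fun j => by
    filter_upwards [eventually_ge_atTop 0] with t ht using hM t ht j
  have bnd' : ∀ j, ∀ τ > 0, ∀ᶠ t in atTop, |z (t + τ) j| ≤ M := fun j τ hτ => by
    filter_upwards [eventually_ge_atTop 0] with t ht using hM (t + τ) (by linarith) j
  have shiftT : ∀ τ : ℝ, Tendsto (fun t : ℝ => t + τ) atTop atTop := fun τ =>
    tendsto_atTop_add_const_right atTop τ tendsto_id
  have s2 : ∀ k, ∀ τ > 0, Tendsto (fun t => μ (t + τ) k - μ t k) atTop (𝓝 0) := by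
    intro k τ hτ
    refine cc_inv (f k) (hfc k) (hf k).2 _ _ M (bnd' (.inr (.inl k)) τ hτ) (bnd (.inr (.inl k))) ?_
    have := (((l1 k).comp (shiftT τ)).sub (l1 k)).add (s3 k τ hτ)
    simp only [sub_zero, add_zero] at this
    refine this.congr fun t => ?_
    simp only [Function.comp]
    ring
  have s4 : ∀ k, ∀ τ > 0, Tendsto (fun t => θ (t + τ) k - θ t k) atTop (𝓝 0) := by
    intro k τ hτ
    refine cc_inv (g k) (hgc k) (hg k).2 _ _ M (bnd' (.inr (.inr (.inr (.inl k)))) τ hτ)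
      (bnd (.inr (.inr (.inr (.inl k))))) ?_
    have := (((l2 k).comp (shiftT τ)).sub (l2 k)).add (s5 k τ hτ)
    simp only [sub_zero, add_zero] at this
    refine this.congr fun t => ?_
    simp only [Function.comp]
    ring
  have barb : ∀ j, (∀ τ > 0, Tendsto (fun t => z (t + τ) j - z t j) atTop (𝓝 0)) →
      Tendsto (fun t => F (z t) j) atTop (𝓝 0) := by
    intro j hj
    have h1 : Continuous (fun w => F w j / T j) :=
      ((continuous_apply j).comp hF).div_const _
    have := cc_barbalat (fun t => z t j) _ (fun t ht => hz t ht j) (huc _ h1) hj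
    have h2 := this.mul_const (T j)
    rw [zero_mul] at h2
    refine h2.congr fun t => ?_
    exact div_mul_cancel₀ _ (hT j).ne'
  have b2 : ∀ k, Tendsto (fun t => ((G.inc)ᵀ *ᵥ (cw h (x t) - ybar)) k) atTop (𝓝 0) := by
    intro k
    have := (barb (.inr (.inl k)) (s2 k)).add (l1 k)
    rw [add_zero] at this
    refine this.congr fun t => ?_
    change ((G.inc)ᵀ *ᵥ (cw h (x t) - ybar)) k - (f k (μ t k) - ξ t k) + (f k (μ t k) - ξ t k) = _
    ring
  have b4 : ∀ k, Tendsto (fun t => ((selE n p)ᵀ *ᵥ (cw h (x t) - ybar)) k) atTop (𝓝 0) := by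
    intro k
    have := ((barb (.inr (.inr (.inr (.inl k)))) (s4 k)).add (l2 k)).neg
    rw [add_zero, neg_zero] at this
    refine this.congr fun t => ?_
    change -(-((selE n p)ᵀ *ᵥ (cw h (x t) - ybar)) k - (g k (θ t k) - φ t k) +
      (g k (θ t k) - φ t k)) = _
    ring
  have incT : ∀ (y : Fin n → ℝ) k, ((G.inc)ᵀ *ᵥ y) k = y (G.pos k) - y (G.neg k) := cc_incT G
  have selT : ∀ (y : Fin n → ℝ) k, ((selE n p)ᵀ *ᵥ y) k = y (Fin.castLE hpn k) := cc_selT hpn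
  have hy : ∀ i, Tendsto (fun t => h i (x t i) - ybar i) atTop (𝓝 0) := by
    intro i
    have hR : ∀ a b, G.Adj a b → Tendsto
        (fun t => (cw h (x t) - ybar) a - (cw h (x t) - ybar) b) atTop (𝓝 0) := by
      rintro a b ⟨k, ⟨rfl, rfl⟩ | ⟨rfl, rfl⟩⟩
      · simpa only [incT] using b2 k
      · have := (b2 k).neg
        simpa only [incT, neg_zero, neg_sub] using this
    have h1 := cc_rtg _ (fun t => cw h (x t) - ybar) hR i (Fin.castLE hpn ⟨0, hp⟩) (hG _ _)
    have h2 := b4 ⟨0, hp⟩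
    simp only [selT] at h2
    have := h1.add h2
    simp only [sub_add_cancel, add_zero] at this
    exact this
  have hxt : ∀ i, Tendsto (fun t => x t i - xb i) atTop (𝓝 0) := by
    intro i
    refine cc_inv (h i) (hhc i) (hh i).2 _ (fun _ => xb i) (max M |xb i|) ?_
      (Eventually.of_forall fun t => le_max_right _ _) ?_
    · filter_upwards [bnd (.inl i)] with t ht using ht.trans (le_max_left _ _)
    · have := hy i
      rw [← hxb] at this
      exact this
  have s1 : ∀ i, ∀ τ > 0, Tendsto (fun t => x (t + τ) i - x t i) atTop (𝓝 0) := by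
    intro i τ hτ
    have := ((hxt i).comp (shiftT τ)).sub (hxt i)
    simpa [Function.comp] using this
  have b1 : ∀ i, Tendsto (fun t => F1 (z t) i) atTop (𝓝 0) := fun i => barb (.inl i) (s1 i)
  obtain ⟨b, hb⟩ := cc_cluster z M hM
  have hlim := fun Φ hΦ c hc => cc_cluster_eq z b hb Φ hΦ c hc
  have eb1 : p1 b = xb := by
    funext i
    have := hlim (fun w => p1 w i - xb i) (by fun_prop) 0 (hxt i)
    exact sub_eq_zero.1 this
  have eb2 : p3 b = cw f (p2 b) := by
    funext k
    have := hlim (fun w => cw f (p2 w) k - p3 w k)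
      (((continuous_apply k).comp cf).sub ((continuous_apply k).comp c3)) 0 (l1 k)
    exact (sub_eq_zero.1 this).symm
  have eb3 : p5 b = cw g (p4 b) := by
    funext k
    have := hlim (fun w => cw g (p4 w) k - p5 w k)
      (((continuous_apply k).comp cg).sub ((continuous_apply k).comp c5)) 0 (l2 k)
    exact (sub_eq_zero.1 this).symm
  have eb4 : ∃ c, ∀ i, q i * cw g (p4 b) i + r i = c := by
    refine ⟨q ⟨0, hp⟩ * cw g (p4 b) ⟨0, hp⟩ + r ⟨0, hp⟩, fun i => ?_⟩
    have := hlim (fun w => (q i * p5 w i + r i) - (q ⟨0, hp⟩ * p5 w ⟨0, hp⟩ + r ⟨0, hp⟩))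
      (by fun_prop) 0 (l3 i ⟨0, hp⟩)
    rw [← eb3]
    exact sub_eq_zero.1 this
  have eb5 : P ybar - G.inc *ᵥ (cw f (p2 b)) + selE n p *ᵥ (cw g (p4 b)) - d = 0 := by
    have h1 : F1 b = 0 := by
      funext i
      exact hlim (fun w => F1 w i) ((continuous_apply i).comp cF1) 0 (b1 i)
    simp only [F1, eb1, hxb] at h1
    exact h1
  have hbst : st xb (p2 b) (cw f (p2 b)) (p4 b) (cw g (p4 b)) = b := by
    rw [← eb1, ← eb2, ← eb3]
    funext j
    rcases j with j | j | j | j | j <;> rfl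
  have keyb := fun w => (key xb (p2 b) (p4 b) hxb eb5 eb4 w).trans (neg_nonpos.2 (hDn w))
  rw [hbst] at keyb
  have hconv := cc_conv H hHc hHm T hT F z hz b keyb hb
  have hcomp := tendsto_pi_nhds.1 hconv
  exact ⟨p1 b, p2 b, p3 b, p4 b, p5 b,
    tendsto_pi_nhds.2 fun i => hcomp (.inl i),
    tendsto_pi_nhds.2 fun i => hcomp (.inr (.inl i)),
    tendsto_pi_nhds.2 fun i => hcomp (.inr (.inr (.inl i))),
    tendsto_pi_nhds.2 fun i => hcomp (.inr (.inr (.inr (.inl i)))),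
    tendsto_pi_nhds.2 fun i => hcomp (.inr (.inr (.inr (.inr i)))),
    by rw [eb1, hxb], eb5, eb4⟩

/-- **Theorem 2.** For the compartmental flow network
`T_x ẋ = Ψ(x) − Bf(μ) + Eg(θ) − d` in closed loop with the controllers, every solution
on `[0,∞)` respects the flow and input constraints and converges to a point with
`h(x*) = ȳ` and `g(θ*) = û`. -/
theorem compartmental_convergence {n m p l pc : ℕ} (hp : 0 < p) (hpn : p ≤ n)
    (G : OrientedGraph n m) (hG : G.Connected) (Gc : OrientedGraph n l)
    (loc : Fin pc → Fin n)
    (h : Fin n → ℝ → ℝ) (hh : ∀ i, ContDiff ℝ 1 (h i) ∧ StrictMono (h i))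
    (f : Fin m → ℝ → ℝ) (hf : ∀ k, ContDiff ℝ 1 (f k) ∧ StrictMono (f k))
    (g : Fin p → ℝ → ℝ) (hg : ∀ i, ContDiff ℝ 1 (g i) ∧ StrictMono (g i))
    (γ : Fin l → ℝ → ℝ) (hγ : ∀ k, Monotone (γ k) ∧ ContDiff ℝ 1 (γ k))
    (η : Fin pc → ℝ → ℝ) (hη : ∀ i, Monotone (η i) ∧ ContDiff ℝ 1 (η i))
    (lamlo lamhi : Fin m → ℝ) (hfr : ∀ k, Set.range (f k) = Set.Ioo (lamlo k) (lamhi k))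
    (ulo uhi : Fin p → ℝ) (hgr : ∀ i, Set.range (g i) = Set.Ioo (ulo i) (uhi i))
    (q r : Fin p → ℝ) (hq : ∀ i, 0 < q i) (d ybar : Fin n → ℝ)
    (hy : ∀ i, ybar i ∈ Set.range (h i))
    (L : Matrix (Fin p) (Fin p) ℝ) (hL : IsBalancedStronglyConnectedLaplacian L)
    (Tx : Fin n → ℝ) (Tm Txi : Fin m → ℝ) (Tth Tph : Fin p → ℝ)
    (hTx : ∀ i, 0 < Tx i) (hTm : ∀ k, 0 < Tm k) (hTxi : ∀ k, 0 < Txi k)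
    (hTth : ∀ i, 0 < Tth i) (hTph : ∀ i, 0 < Tph i)
    -- `d̂ = d + E_c η(E_cᵀ ȳ)` and `û = Q⁻¹(λ̂·1ₚ − r)`
    (dhat : Fin n → ℝ)
    (hdhat : dhat = d + (locMatrix n loc).mulVec (cw η ((locMatrix n loc)ᵀ.mulVec ybar)))
    (hu : ∀ i, uOpt q r dhat i ∈ Set.range (g i))
    -- attainability: `Bλ̄ = Ψ(x̄) + Eû − d` with `h(x̄) = ȳ`
    (xb : Fin n → ℝ) (hxb : cw h xb = ybar)
    (hlam : ∃ lb : Fin m → ℝ,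
      G.inc.mulVec lb =
        (-(Gc.inc.mulVec (cw γ ((Gc.inc)ᵀ.mulVec (cw h xb)))) -
          (locMatrix n loc).mulVec (cw η ((locMatrix n loc)ᵀ.mulVec (cw h xb)))) +
        (selE n p).mulVec (uOpt q r dhat) - d ∧
      ∀ k, lb k ∈ Set.range (f k))
    -- a solution of the closed-loop system on [0, ∞)
    (x : ℝ → Fin n → ℝ) (μ ξ : ℝ → Fin m → ℝ) (θ φ : ℝ → Fin p → ℝ)
    (hxode : ∀ t, 0 ≤ t → ∀ i, HasDerivAt (fun s => x s i)
      ((((-(Gc.inc.mulVec (cw γ ((Gc.inc)ᵀ.mulVec (cw h (x t))))) -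
          (locMatrix n loc).mulVec (cw η ((locMatrix n loc)ᵀ.mulVec (cw h (x t))))) -
         G.inc.mulVec (cw f (μ t)) + (selE n p).mulVec (cw g (θ t)) - d) i) / Tx i) t)
    (hμode : ∀ t, 0 ≤ t → ∀ k, HasDerivAt (fun s => μ s k)
      ((((G.inc)ᵀ.mulVec (cw h (x t) - ybar) - (cw f (μ t) - ξ t)) k) / Tm k) t)
    (hξode : ∀ t, 0 ≤ t → ∀ k, HasDerivAt (fun s => ξ s k)
      (((cw f (μ t) - ξ t) k) / Txi k) t)
    (hθode : ∀ t, 0 ≤ t → ∀ i, HasDerivAt (fun s => θ s i)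
      (((-((selE n p)ᵀ.mulVec (cw h (x t) - ybar)) - (cw g (θ t) - φ t)) i) / Tth i) t)
    (hφode : ∀ t, 0 ≤ t → ∀ i, HasDerivAt (fun s => φ s i)
      (((cw g (θ t) - φ t -
        (Matrix.diagonal q).mulVec (L.mulVec ((Matrix.diagonal q).mulVec (φ t) + r))) i)
        / Tph i) t) :
    -- constraints hold for all t ≥ 0
    (∀ t, 0 ≤ t →
      (∀ k, lamlo k < f k (μ t k) ∧ f k (μ t k) < lamhi k) ∧
      (∀ i, ulo i < g i (θ t i) ∧ g i (θ t i) < uhi i)) ∧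
    -- convergence to a steady state with output regulation and optimal inputs
    (∃ (xs : Fin n → ℝ) (ms xis : Fin m → ℝ) (ths phs : Fin p → ℝ),
      Tendsto x atTop (𝓝 xs) ∧ Tendsto μ atTop (𝓝 ms) ∧ Tendsto ξ atTop (𝓝 xis) ∧
      Tendsto θ atTop (𝓝 ths) ∧ Tendsto φ atTop (𝓝 phs) ∧
      cw h xs = ybar ∧ cw g ths = uOpt q r dhat) := by
  refine ⟨fun t _ => ⟨fun k => ?_, fun i => ?_⟩, ?_⟩
  · have : f k (μ t k) ∈ Set.Ioo (lamlo k) (lamhi k) := hfr k ▸ Set.mem_range_self _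
    exact this
  · have : g i (θ t i) ∈ Set.Ioo (ulo i) (uhi i) := hgr i ▸ Set.mem_range_self _
    exact this
  obtain ⟨lb, hlb, hlbr⟩ := hlam
  choose mb hmb using hlbr
  choose tb htb using hu
  have hmb' : cw f mb = lb := funext hmb
  have htb' : cw g tb = uOpt q r dhat := funext htb
  let P : (Fin n → ℝ) → Fin n → ℝ := fun y =>
    -(Gc.inc.mulVec (cw γ ((Gc.inc)ᵀ.mulVec y))) -
          (locMatrix n loc).mulVec (cw η ((locMatrix n loc)ᵀ.mulVec y))
  have cwc : ∀ {k : ℕ} (γ : Fin k → ℝ → ℝ) (M : Matrix (Fin n) (Fin k) ℝ),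
      (∀ k, Continuous (γ k)) → Continuous (fun y : Fin n → ℝ => M *ᵥ cw γ (Mᵀ *ᵥ y)) := by
    intro k γ M hγ
    have h1 : Continuous (fun y : Fin n → ℝ => Mᵀ *ᵥ y) :=
      continuous_const.matrix_mulVec continuous_id
    refine continuous_const.matrix_mulVec (continuous_pi fun i => ?_)
    exact (hγ i).comp ((continuous_apply i).comp h1)
  have hPc : Continuous P :=
    (cwc γ _ fun k => (hγ k).2.continuous).neg.sub (cwc η _ fun k => (hη k).2.continuous)
  have hP : ∀ y, (y - ybar) ⬝ᵥ (P y - P ybar) ≤ 0 := by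
    intro y
    have h1 := cc_mono Gc.inc γ (fun k => (hγ k).1) y ybar
    have h2 := cc_mono (locMatrix n loc) η (fun k => (hη k).1) y ybar
    have e : P y - P ybar = -((Gc.inc *ᵥ cw γ ((Gc.inc)ᵀ *ᵥ y) - Gc.inc *ᵥ cw γ ((Gc.inc)ᵀ *ᵥ ybar)) +
        (locMatrix n loc *ᵥ cw η ((locMatrix n loc)ᵀ *ᵥ y) -
          locMatrix n loc *ᵥ cw η ((locMatrix n loc)ᵀ *ᵥ ybar))) := by
      simp only [P]
      abel
    rw [e, dotProduct_neg, dotProduct_add]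
    linarith
  have heq : P ybar - G.inc *ᵥ (cw f mb) + selE n p *ᵥ (cw g tb) - d = 0 := by
    rw [hmb', htb', hlb, hxb]
    simp only [P]
    abel
  have hcb : ∃ c, ∀ i, q i * cw g tb i + r i = c := by
    refine ⟨lamStar q r dhat, fun i => ?_⟩
    rw [htb']
    have := (hq i).ne'
    simp only [uOpt]
    field_simp
    ring
  obtain ⟨xs, ms, xis, ths, phs, t1, t2, t3, t4, t5, e1, e2, c, e3⟩ :=
    cc_core hp hpn G hG h (fun i => ⟨(hh i).1.continuous, (hh i).2⟩)
      f (fun i => ⟨(hf i).1.continuous, (hf i).2⟩) g (fun i => ⟨(hg i).1.continuous, (hg i).2⟩)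
      P hPc q r d ybar hP L hL Tx Tm Txi Tth Tph hTx hTm hTxi hTth hTph xb hxb mb tb heq hcb
      x μ ξ θ φ hxode hμode hξode hθode hφode
  refine ⟨xs, ms, xis, ths, phs, t1, t2, t3, t4, t5, e1, ?_⟩
  have sB : ∑ i, (G.inc *ᵥ cw f ms) i = 0 := by
    rw [cc_sum_mulVec]
    simp [cc_incT]
  have sBc : ∑ i, (Gc.inc *ᵥ cw γ ((Gc.inc)ᵀ *ᵥ ybar)) i = 0 := by
    rw [cc_sum_mulVec]
    simp [cc_incT]
  have sE : ∑ i, (selE n p *ᵥ cw g ths) i = ∑ i, cw g ths i := by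
    rw [cc_sum_mulVec]
    simp [cc_selT hpn]
  have sd : ∑ i, dhat i = ∑ i, d i +
      ∑ i, (locMatrix n loc *ᵥ cw η ((locMatrix n loc)ᵀ *ᵥ ybar)) i := by
    rw [hdhat, ← Finset.sum_add_distrib]
    rfl
  have sum0 : ∑ i, (P ybar - G.inc *ᵥ (cw f ms) + selE n p *ᵥ (cw g ths) - d) i = 0 := by
    rw [e2]; simp
  simp only [P, Pi.sub_apply, Pi.add_apply, Pi.neg_apply, Finset.sum_add_distrib,
    Finset.sum_sub_distrib, Finset.sum_neg_distrib, sB, sBc, sE] at sum0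
  have sg : ∑ i, cw g ths i = ∑ i, dhat i := by linarith
  have hgi : ∀ i, cw g ths i = c * (q i)⁻¹ - r i / q i := by
    intro i
    have := (hq i).ne'
    rw [← e3 i]
    field_simp
    ring
  have hpos : 0 < ∑ i, (q i)⁻¹ :=
    Finset.sum_pos (fun i _ => inv_pos.2 (hq i)) ⟨⟨0, hp⟩, Finset.mem_univ _⟩
  have hsum : ∑ i, cw g ths i = c * ∑ i, (q i)⁻¹ - ∑ i, r i / q i := by
    rw [Finset.mul_sum, ← Finset.sum_sub_distrib]
    exact Finset.sum_congr rfl fun i _ => hgi i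
  have hlamc : lamStar q r dhat = c := by
    rw [lamStar, div_eq_iff hpos.ne']
    linarith
  funext i
  rw [hgi i, uOpt, hlamc, sub_div]
  rfl
end
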